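/- If two standard circular weighted graphs, namely cycles of length at least 4 whose weight sequences read along the cycle are (0,...,0 (2k zeros), w_1,...,w_n) and (0,...,0 (2k' zeros), w'_1,...,w'_{n'}) with n, n' >= 1 and all w_i, w'_j <= -2, are birationally equivalent, then k = k', n = n', and the tuple (w'_1,...,w'_n) is obtained from (w_1,...,w_n) by a cyclic permutation, possibly followed by reversal of the order; in other words, a circular standard graph is unique in its birational equivalence class up to a cyclic permutation of its nonzero weights and reversion. -/

import Mathlib

/-- A weighted graph: a finite simple graph on a finite set of natural-number
vertices, with an integer weight attached to each vertex. -/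
structure WGraph where
  verts : Finset ℕ
  adj : ℕ → ℕ → Bool
  symm : ∀ u v, adj u v = true → adj v u = true
  loopless : ∀ v, adj v v = false
  support : ∀ u v, adj u v = true → u ∈ verts ∧ v ∈ verts
  wt : ℕ → ℤ

namespace WGraph

/-- The degree of a vertex. -/
def deg (G : WGraph) (v : ℕ) : ℕ := (G.verts.filter (fun u => G.adj v u = true)).card

/-- A branching point: a vertex of degree at least `3`. -/
def Branch (G : WGraph) (v : ℕ) : Prop := v ∈ G.verts ∧ 3 ≤ G.deg v

/-- The graph is connected (and nonempty). -/
def Connected (G : WGraph) : Prop :=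
  G.verts.Nonempty ∧ ∀ u ∈ G.verts, ∀ v ∈ G.verts,
    Relation.ReflTransGen (fun a b => G.adj a b = true) u v

/-- A circular graph: a nonempty connected graph all of whose vertices have degree `2`,
i.e. a cycle. -/
def IsCircular (G : WGraph) : Prop :=
  G.verts.Nonempty ∧ G.Connected ∧ ∀ v ∈ G.verts, G.deg v = 2

/-- The set of non-branching vertices. -/
def NB (G : WGraph) : Set ℕ := {v | v ∈ G.verts ∧ G.deg v < 3}

/-- A linear segment: a connected component of the graph obtained by deleting
the branching points. -/
def IsSegment (G : WGraph) (S : Set ℕ) : Prop :=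
  ∃ v ∈ G.NB, S = {u | Relation.ReflTransGen
    (fun a b => a ∈ G.NB ∧ b ∈ G.NB ∧ G.adj a b = true) v u}

/-- `l` is a consecutive enumeration of the linear segment `S`. -/
def SegList (G : WGraph) (S : Set ℕ) (l : List ℕ) : Prop :=
  l.Nodup ∧ (∀ v, v ∈ l ↔ v ∈ S) ∧ l.Chain' (fun a b => G.adj a b = true)

/-- A standard weight sequence: all weights zero, or an even number `2k ≥ 0` of zeros
followed by weights `≤ -2`. -/
def StdSeq (m : List ℤ) : Prop :=
  (∀ x ∈ m, x = 0) ∨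
  ∃ (k : ℕ) (ws : List ℤ), m = List.replicate (2 * k) 0 ++ ws ∧ ∀ x ∈ ws, x ≤ -2

/-- A standard weighted graph: connected, and every linear segment, enumerated
consecutively starting (when the segment is adjacent to exactly one branching point)
from the vertex adjacent to that branching point, has a standard weight sequence. -/
def IsStandard (G : WGraph) : Prop :=
  G.Connected ∧
  ∀ S, G.IsSegment S → ∃ l, G.SegList S l ∧ StdSeq (l.map G.wt) ∧
    ∀ b, G.Branch b → (∃ v ∈ S, G.adj b v = true) →
      (∀ b', G.Branch b' → (∃ v' ∈ S, G.adj b' v' = true) → b' = b) →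
      ∃ v0, l.head? = some v0 ∧ G.adj b v0 = true

/-- `G'` is obtained from `G` by the inner blowup at the edge `uv`, creating the
new vertex `x`: the edge `uv` is deleted, `x` gets weight `-1` and is joined to
`u` and `v`, and the weights of `u` and `v` drop by `1`. -/
def IsInnerBlowup (G G' : WGraph) (u v x : ℕ) : Prop :=
  G.adj u v = true ∧ x ∉ G.verts ∧
  G'.verts = insert x G.verts ∧
  (∀ a b, G'.adj a b = true ↔
    ((G.adj a b = true ∧ ¬(a = u ∧ b = v) ∧ ¬(a = v ∧ b = u)) ∨
     (a = x ∧ (b = u ∨ b = v)) ∨ (b = x ∧ (a = u ∨ a = v)))) ∧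
  (∀ a, G'.wt a = if a = x then -1 else if a = u then G.wt a - 1
    else if a = v then G.wt a - 1 else G.wt a)

/-- `G'` is obtained from `G` by the outer blowup at the vertex `v`, creating the
new vertex `x` of weight `-1` joined only to `v`; the weight of `v` drops by `1`. -/
def IsOuterBlowup (G G' : WGraph) (v x : ℕ) : Prop :=
  v ∈ G.verts ∧ x ∉ G.verts ∧
  G'.verts = insert x G.verts ∧
  (∀ a b, G'.adj a b = true ↔
    (G.adj a b = true ∨ (a = x ∧ b = v) ∨ (b = x ∧ a = v))) ∧
  (∀ a, G'.wt a = if a = x then -1 else if a = v then G.wt a - 1 else G.wt a)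

/-- A single blowup. -/
def BlowupStep (G G' : WGraph) : Prop :=
  (∃ u v x, IsInnerBlowup G G' u v x) ∨ (∃ v x, IsOuterBlowup G G' v x)

/-- A single blowup or blowdown (a blowdown being the inverse of a blowup). -/
def Move (G G' : WGraph) : Prop := BlowupStep G G' ∨ BlowupStep G' G

/-- A weight-preserving isomorphism of weighted graphs. -/
def WIso (G G' : WGraph) : Prop :=
  ∃ f : ℕ → ℕ, Set.BijOn f (G.verts : Set ℕ) (G'.verts : Set ℕ) ∧
    (∀ u ∈ G.verts, ∀ v ∈ G.verts, G'.adj (f u) (f v) = G.adj u v) ∧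
    (∀ v ∈ G.verts, G'.wt (f v) = G.wt v)

/-- Birational equivalence of weighted graphs: the equivalence relation generated by
blowups, blowdowns and weight-preserving isomorphisms. -/
def BirEq : WGraph → WGraph → Prop :=
  Relation.EqvGen (fun G G' => Move G G' ∨ WIso G G')

end WGraph

namespace WGraph

/-- `l` is a cyclic consecutive enumeration of the vertices of the circular graph `G`. -/
def CycList (G : WGraph) (l : List ℕ) : Prop :=
  l.Nodup ∧ (∀ v, v ∈ l ↔ v ∈ G.verts) ∧
  l.Chain' (fun a b => G.adj a b = true) ∧
  (∀ a b, l.head? = some a → l.getLast? = some b → G.adj b a = true)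

end WGraph

namespace CycU

def dt (u v : ℤ × ℤ) : ℤ := u.1 * v.2 - u.2 * v.1

structure Sq (a : ℤ → ℤ) (q : ℤ → ℤ × ℤ) : Prop where
  r : ∀ i, q (i - 1) + q (i + 1) = a i • q i
  d : ∀ i, dt (q i) (q (i + 1)) = 1

lemma Sq.r1 {a q} (h : Sq a q) (i : ℤ) : (q (i - 1)).1 + (q (i + 1)).1 = a i * (q i).1 := by
  have := congrArg Prod.fst (h.r i); simpa using this

lemma Sq.r2 {a q} (h : Sq a q) (i : ℤ) : (q (i - 1)).2 + (q (i + 1)).2 = a i * (q i).2 := by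
  have := congrArg Prod.snd (h.r i); simpa using this

lemma mono_aux {a h : ℤ → ℤ} (ha : ∀ i, 2 ≤ a i) (hr : ∀ i, h (i - 1) + h (i + 1) = a i * h i)
    (j : ℤ) (h0 : 0 ≤ h j) (h1 : h j ≤ h (j + 1)) (m : ℤ) (hm : j ≤ m) :
    0 ≤ h m ∧ h m ≤ h (m + 1) := by
  induction m, hm using Int.leInduction with
  | base => exact ⟨h0, h1⟩
  | succ m hm ih =>
    have := hr (m + 1)
    rw [show m + 1 - 1 = m by ring] at this
    refine ⟨by linarith [ih.1, ih.2], ?_⟩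
    nlinarith [ha (m + 1), ih.1, ih.2]

lemma mono_le {a h : ℤ → ℤ} (ha : ∀ i, 2 ≤ a i) (hr : ∀ i, h (i - 1) + h (i + 1) = a i * h i)
    (j : ℤ) (h0 : 0 ≤ h j) (h1 : h j ≤ h (j + 1)) (m : ℤ) (hm : j ≤ m) :
    h j ≤ h m := by
  induction m, hm using Int.leInduction with
  | base => exact le_rfl
  | succ m hm ih => exact ih.trans (mono_aux ha hr j h0 h1 m hm).2

lemma Sq.pos {a q} (h : Sq a q) (ha : ∀ i, 2 ≤ a i) (i m : ℤ) (him : i < m) :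
    0 < dt (q i) (q m) := by
  obtain ⟨g, hg⟩ : ∃ g : ℤ → ℤ, g = fun m => dt (q i) (q m) := ⟨_, rfl⟩
  have hr : ∀ m, g (m - 1) + g (m + 1) = a m * g m := by
    intro m
    simp only [hg, dt]
    linear_combination (q i).1 * h.r2 m - (q i).2 * h.r1 m
  have e0 : dt (q i) (q i) = 0 := by simp only [dt]; ring
  have e1 := h.d i
  have k1 := mono_aux ha hr i (by simp [hg, e0]) (by simp [hg, e0, e1]) (i + 1) (by linarith)
  have k2 := mono_le ha hr (i + 1) k1.1 k1.2 m (by linarith)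
  simp only [hg, e1] at k2
  linarith

def InC (q : ℤ → ℤ × ℤ) (v : ℤ × ℤ) : Prop :=
  ∃ i x y : ℤ, 0 ≤ x ∧ 0 ≤ y ∧ v = x • q i + y • q (i + 1)

lemma dt_add (u v w : ℤ × ℤ) (x y : ℤ) : dt u (x • v + y • w) = x * dt u v + y * dt u w := by
  simp [dt]; ring

lemma dt_neg (u v : ℤ × ℤ) : dt u (-v) = - dt u v := by
  simp [dt]; ring

lemma dt_anti (u v : ℤ × ℤ) : dt u v = - dt v u := by
  simp [dt]; ring

lemma InC.ends {a q} (h : Sq a q) (ha : ∀ i, 2 ≤ a i) {v : ℤ × ℤ} (hv : v ≠ 0) (hc : InC q v) :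
    ∃ i, (∀ m < i, 0 < dt (q m) v) ∧ (∀ m > i, dt (q m) v < 0) := by
  obtain ⟨i, x, y, hx, hy, rfl⟩ := hc
  have hxy : 0 < x + y := by
    rcases hx.lt_or_eq with h1 | h1
    · linarith
    · rcases hy.lt_or_eq with h2 | h2
      · linarith
      · subst h1; subst h2; simp at hv
  have key : ∀ s t : ℤ, 0 < s → 0 < t → 0 < x * s + y * t := by
    intro s t hs ht
    nlinarith [mul_nonneg hx (by linarith : 0 ≤ s - 1), mul_nonneg hy (by linarith : 0 ≤ t - 1)]
  by_cases hx0 : 0 < x ∧ y = 0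
  · refine ⟨i, fun m hm => ?_, fun m hm => ?_⟩
    · rw [dt_add]
      exact key _ _ (h.pos ha _ _ hm) (h.pos ha _ _ (by linarith))
    · rw [dt_add, dt_anti (q m), hx0.2]
      nlinarith [h.pos ha _ _ hm, hx0.1]
  · refine ⟨i + 1, fun m hm => ?_, fun m hm => ?_⟩
    · rw [dt_add]
      rcases (Int.lt_add_one_iff.1 hm).lt_or_eq with hm' | rfl
      · exact key _ _ (h.pos ha _ _ hm') (h.pos ha _ _ (by linarith))
      · rw [h.d, show dt (q m) (q m) = 0 by simp only [dt]; ring]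
        have : y ≠ 0 := fun hy0 => hx0 ⟨by linarith, hy0⟩
        have : 0 < y := lt_of_le_of_ne hy this.symm
        linarith
    · rw [dt_add, dt_anti (q m), dt_anti (q m) (q (i+1))]
      have := key _ _ (h.pos ha i m (by linarith)) (h.pos ha (i + 1) m hm)
      linarith

lemma no_pos (f : ℤ → ℤ) (n : ℕ) (E : ℤ) (hE : 0 < E) (hf : ∀ i, 0 < f i)
    (hW : ∀ i, f i * f (i + 1 - n) - f (i + 1) * f (i - n) = E) : n = 0 := by
  by_contra hn
  obtain ⟨i0, hi0⟩ : ∃ i0, ∀ i, f i0 ≤ f i := by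
    have := WellFounded.has_min (measure (fun i => (f i).toNat)).wf Set.univ ⟨0, trivial⟩
    obtain ⟨i0, -, h⟩ := this
    refine ⟨i0, fun i => ?_⟩
    have := h i trivial
    simp only [WellFoundedRelation.rel, InvImage] at this
    have h1 := hf i
    have h2 := hf i0
    simp at this
    omega
  -- ratio increasing
  have key : ∀ m : ℕ, 1 ≤ m → f (i0 - n) * f (i0 + m) < f (i0 + m - n) * f i0 := by
    intro m hm
    induction m, hm using Nat.le_induction with
    | base => have := hW i0; push_cast; nlinarith
    | succ m hm ih =>
      have h1 := hW (i0 + m)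
      push_cast
      rw [show i0 + (m + 1 : ℤ) = i0 + m + 1 by ring]
      have p1 := hf (i0 + m)
      have p2 := hf (i0 + m + 1)
      have p3 := hf i0
      have : f (i0 + m) * (f (i0 - n) * f (i0 + m + 1)) < f (i0 + m) * (f (i0 + m + 1 - n) * f i0) := by
        have e : f (i0 + m) * (f (i0 + m + 1 - n) * f i0) = (E + f (i0 + m + 1) * f (i0 + m - n)) * f i0 := by
          rw [← h1]; ring
        rw [e]
        nlinarith [mul_pos hE p3, mul_lt_mul_of_pos_left ih p2]
      exact lt_of_mul_lt_mul_left this p1.le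
  have h1 := key n (by omega)
  rw [show i0 + (n:ℤ) - n = i0 by ring] at h1
  have := mul_le_mul (hi0 (i0 - n)) (hi0 (i0 + n)) (hf i0).le (hf _).le
  linarith

lemma dich {a q} (h : Sq a q) (S : ℤ × ℤ → ℤ × ℤ) (hS : ∀ u v, dt (S u) (S v) = dt u v)
    (n : ℕ) (hn : 1 ≤ n) (hq : ∀ i, S (q i) = q (i + n)) (v : ℤ × ℤ) (hv : 0 < dt v (S v)) :
    InC q v ∨ InC q (-v) := by
  have hg : ∀ i, dt (q i) (S v) = dt (q (i - n)) v := by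
    intro i
    rw [← hS (q (i - n)) v, hq]; congr 2; ring
  have hv' : ∀ i, v = (- dt (q (i + 1)) v) • q i + dt (q i) v • q (i + 1) := by
    intro i
    have := h.d i
    simp only [dt] at this ⊢
    ext
    · simp
      linear_combination (-v.1) * this
    · simp
      linear_combination (-v.2) * this
  by_cases hz : ∃ i, dt (q i) v * dt (q (i + 1)) v ≤ 0
  · obtain ⟨i, hi⟩ := hz
    rcases mul_nonpos_iff.1 hi with ⟨h1, h2⟩ | ⟨h1, h2⟩
    · exact Or.inl ⟨i, _, _, by linarith, h1, hv' i⟩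
    · refine Or.inr ⟨i, dt (q (i + 1)) v, - dt (q i) v, h2, by linarith, ?_⟩
      conv_lhs => rw [hv' i]
      simp; abel
  · push Not at hz
    exfalso
    have hW : ∀ i, dt (q i) v * dt (q (i + 1 - n)) v - dt (q (i + 1)) v * dt (q (i - n)) v
        = dt v (S v) := by
      intro i
      rw [← hg, ← hg]
      have := h.d i
      simp only [dt] at this ⊢
      linear_combination (v.1 * (S v).2 - v.2 * (S v).1) * this
    have hs : ∀ i, 0 < dt (q i) v * dt (q 0) v := by
      intro i
      induction i using Int.induction_on with
      | zero =>
        have := hz 0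
        have : dt (q 0) v ≠ 0 := by intro h0; rw [h0] at this; simp at this
        exact mul_self_pos.2 this
      | succ i ih =>
        have h1 := hz i
        have h2 := mul_pos h1 ih
        by_contra h3
        push Not at h3
        nlinarith [mul_nonneg (sq_nonneg (dt (q i) v)) (by linarith : 0 ≤ - (dt (q (i + 1)) v * dt (q 0) v))]
      | pred i ih =>
        have h1 := hz (-i - 1)
        rw [show (-i - 1 + 1 : ℤ) = -i by ring] at h1
        have h2 := mul_pos h1 ih
        by_contra h3
        push Not at h3
        nlinarith [mul_nonneg (sq_nonneg (dt (q (-i)) v)) (by linarith : 0 ≤ - (dt (q (-i - 1)) v * dt (q 0) v))]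
    have h00 := hs 0
    rcases lt_or_ge 0 (dt (q 0) v) with h0 | h0
    · have := no_pos (fun i => dt (q i) v) n _ hv (fun i => pos_of_mul_pos_left (hs i) h0.le) hW
      omega
    · have := no_pos (fun i => - dt (q i) v) n _ hv
        (fun i => by
          have := hs i
          by_contra h3
          push Not at h3
          nlinarith) (fun i => by rw [← hW i]; ring)
      omega

lemma Sq.ne0 {a q} (h : Sq a q) (i : ℤ) : q i ≠ 0 := by
  intro h0
  have := h.d i
  rw [h0] at this
  simp [dt] at this

lemma side {a q a' q'} (h : Sq a q) (ha : ∀ i, 2 ≤ a i) (h' : Sq a' q') (ha' : ∀ i, 2 ≤ a' i)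
    (S : ℤ × ℤ → ℤ × ℤ) (hS : ∀ u v, dt (S u) (S v) = dt u v)
    (n n' : ℕ) (hn : 1 ≤ n) (hn' : 1 ≤ n') (hq : ∀ i, S (q i) = q (i + n))
    (hq' : ∀ i, S (q' i) = q' (i + n')) (hc : InC q (q' 0)) (i : ℤ) : InC q' (q i) := by
  have hp : 0 < dt (q i) (S (q i)) := by
    rw [hq]; exact h.pos ha _ _ (by omega)
  rcases dich h' S hS n' hn' hq' (q i) hp with h1 | h1
  · exact h1
  exfalso
  obtain ⟨i1, -, hi1⟩ := hc.ends h ha (h'.ne0 0)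
  obtain ⟨i2, hi2, -⟩ := h1.ends h' ha' (by simpa using h.ne0 i)
  have hD : ∀ t : ℕ, ∀ i, dt (q i) (q' (-(t * n'))) = dt (q (i + t * n)) (q' 0) := by
    intro t
    induction t with
    | zero => simp
    | succ t ih =>
      intro i
      have e := ih (i + n)
      rw [← hS, hq, hq', show (-(((t + 1 : ℕ) : ℤ) * n') + n' : ℤ) = -(t * n') by push_cast; ring, e]
      congr 2; push_cast; ring
  obtain ⟨t, ht⟩ : ∃ t : ℕ, (t : ℤ) = |i1 - i| + |i2| + 1 := ⟨(|i1 - i| + |i2| + 1).toNat, by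
    rw [Int.toNat_of_nonneg]; positivity⟩
  have n1 : (1 : ℤ) ≤ n := by exact_mod_cast hn
  have n2 : (1 : ℤ) ≤ n' := by exact_mod_cast hn'
  have b1 : (t : ℤ) ≤ t * n := by nlinarith
  have b2 : (t : ℤ) ≤ t * n' := by nlinarith
  have c1 := le_abs_self (i1 - i)
  have c2 := neg_abs_le i2
  have c3 := abs_nonneg i2
  have c4 := abs_nonneg (i1 - i)
  have k1 := hi1 (i + t * n) (by linarith)
  have k2 := hi2 (-(t * n')) (by linarith)
  rw [dt_neg, dt_anti, hD] at k2
  linarith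

lemma fexp_aux {a h : ℤ → ℤ} (ha : ∀ i, 2 ≤ a i) (hr : ∀ i, h (i - 1) + h (i + 1) = a i * h i)
    (j : ℤ) (h0 : h j = 1) (h1 : h (j + 1) = 1) (m : ℤ) : 1 ≤ h m := by
  rcases le_total j m with hm | hm
  · have := mono_le ha hr j (by omega) (by omega) m hm
    omega
  · have := mono_le (a := fun i => a (-i)) (h := fun i => h (-i)) (fun i => ha _)
      (fun i => by
        have := hr (-i)
        rw [← this, show -(i - 1) = -i + 1 by ring, show -(i + 1) = -i - 1 by ring]; ring)
      (-(j + 1)) (by simp only [neg_neg]; omega)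
        (by simp only [neg_neg]; rw [show -(-(j + 1) + 1) = j by ring]; omega) (-m) (by omega)
    simp only [neg_neg] at this
    omega

lemma fexp {a q} (h : Sq a q) (ha : ∀ i, 2 ≤ a i) (j : ℤ) (v : ℤ × ℤ) (hv : v ≠ 0)
    (hc : InC q v) : 1 ≤ dt v (q (j + 1)) + dt (q j) v := by
  have hL := fexp_aux (h := fun m => dt (q m) (q (j + 1)) + dt (q j) (q m)) ha
    (fun m => by
      simp only [dt]
      linear_combination ((q (j + 1)).2 - (q j).2) * h.r1 m + ((q j).1 - (q (j + 1)).1) * h.r2 m) j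
    (by simp only [h.d]; simp only [dt]; ring) (by simp only [h.d]; simp only [dt]; ring)
  obtain ⟨i, x, y, hx, hy, rfl⟩ := hc
  have hxy : 0 < x + y := by
    rcases hx.lt_or_eq with h1 | h1
    · linarith
    · rcases hy.lt_or_eq with h2 | h2
      · linarith
      · subst h1; subst h2; simp at hv
  have l1 := hL i
  have l2 := hL (i + 1)
  rw [dt_anti (_ + _), dt_add, dt_add]
  rw [dt_anti] at l1 l2
  nlinarith

lemma vert {a q a' q'} (h : Sq a q) (ha : ∀ i, 2 ≤ a i) (h' : Sq a' q') (ha' : ∀ i, 2 ≤ a' i)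
    (hc : ∀ i, InC q' (q i)) (hc' : ∀ i, InC q (q' i)) (j : ℤ) : ∃ i, q' j = q i := by
  obtain ⟨i, x, y, hx, hy, e⟩ := hc' j
  have l1 := fexp h' ha' j _ (h.ne0 i) (hc i)
  have l2 := fexp h' ha' j _ (h.ne0 (i + 1)) (hc (i + 1))
  have l3 : dt (q' j) (q' (j + 1)) + dt (q' j) (q' j) = 1 := by
    rw [h'.d]; simp only [dt]; ring
  have hne := h'.ne0 j
  have l4 : x * (dt (q i) (q' (j + 1)) + dt (q' j) (q i))
      + y * (dt (q (i+1)) (q' (j + 1)) + dt (q' j) (q (i+1))) = 1 := by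
    have e1 : dt (q' j) (q' j) = x * dt (q' j) (q i) + y * dt (q' j) (q (i+1)) := by
      conv_lhs => rw [show dt (q' j) (q' j) = dt (q' j) (x • q i + y • q (i + 1)) by rw [← e]]
      rw [dt_add]
    have e2 : dt (q' j) (q' (j + 1)) = x * dt (q i) (q' (j+1)) + y * dt (q (i+1)) (q' (j+1)) := by
      rw [dt_anti, show dt (q' (j+1)) (q' j) = dt (q' (j+1)) (x • q i + y • q (i + 1)) by rw [← e],
        dt_add, dt_anti (q i), dt_anti (q (i+1))]
      ring
    linear_combination l3 - e1 - e2
  have hxy : x + y ≤ 1 := by nlinarith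
  have : (x = 0 ∧ y = 0) ∨ (x = 1 ∧ y = 0) ∨ (x = 0 ∧ y = 1) := by omega
  rcases this with ⟨rfl, rfl⟩ | ⟨rfl, rfl⟩ | ⟨rfl, rfl⟩
  · simp at e; exact absurd e hne
  · exact ⟨i, by simpa using e⟩
  · exact ⟨i + 1, by simpa using e⟩

lemma Sq.lt_iff {a q} (h : Sq a q) (ha : ∀ i, 2 ≤ a i) (i j : ℤ) : 0 < dt (q i) (q j) ↔ i < j := by
  refine ⟨fun hp => ?_, h.pos ha i j⟩
  by_contra hij
  push Not at hij
  rcases hij.lt_or_eq with h1 | h1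
  · have := h.pos ha _ _ h1
    rw [dt_anti] at this; omega
  · subst h1; simp only [dt] at hp; nlinarith

lemma uniq_pos {a q a' q'} (h : Sq a q) (ha : ∀ i, 2 ≤ a i) (h' : Sq a' q') (ha' : ∀ i, 2 ≤ a' i)
    (S : ℤ × ℤ → ℤ × ℤ) (hS : ∀ u v, dt (S u) (S v) = dt u v)
    (n n' : ℕ) (hn : 1 ≤ n) (hn' : 1 ≤ n') (hq : ∀ i, S (q i) = q (i + n))
    (hq' : ∀ i, S (q' i) = q' (i + n')) (hc : InC q (q' 0)) :
    n = n' ∧ ∃ s : ℤ, ∀ j, a' j = a (j + s) := by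
  have hc1 := side h ha h' ha' S hS n n' hn hn' hq hq' hc
  have hc2 := side h' ha' h ha S hS n' n hn' hn hq' hq (hc1 0)
  choose σ hσ using vert h ha h' ha' hc1 hc2
  choose τ hτ using vert h' ha' h ha hc2 hc1
  have inj : ∀ i j, q i = q j → i = j := by
    intro i j e
    rcases lt_trichotomy i j with h1 | h1 | h1
    · have := h.pos ha _ _ h1
      rw [e] at this; simp only [dt] at this; nlinarith
    · exact h1
    · have := h.pos ha _ _ h1
      rw [e] at this; simp only [dt] at this; nlinarith
  have hmono : ∀ i j, i < j ↔ σ i < σ j := by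
    intro i j
    rw [← h.lt_iff ha (σ i), ← h'.lt_iff ha' i j, hσ, hσ]
  have hst : ∀ i, σ (τ i) = i := fun i => inj _ _ (by rw [← hσ, ← hτ])
  have hstep : ∀ j, σ (j + 1) = σ j + 1 := by
    intro j
    have h1 : σ j < σ (j + 1) := (hmono _ _).1 (by omega)
    have h2 : j < τ (σ j + 1) := (hmono _ _).2 (by rw [hst]; omega)
    have h3 : ¬ (τ (σ j + 1) < j + 1) := by omega
    rw [hmono, hst] at h3
    omega
  have hsh : ∀ j, σ j = j + σ 0 := by
    intro j
    induction j using Int.induction_on with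
    | zero => simp
    | succ i ih => rw [hstep, ih]; ring
    | pred i ih =>
      have := hstep (-i - 1)
      rw [show (-i - 1 + 1 : ℤ) = -i by ring] at this
      linarith
  have hqq : ∀ j, q' j = q (j + σ 0) := fun j => by rw [hσ, hsh]
  refine ⟨?_, σ 0, fun j => ?_⟩
  · have e := hq' 0
    rw [hqq, hqq, hq] at e
    have := inj _ _ e
    omega
  · have e1 := h'.r j
    have e2 := h.r (j + σ 0)
    rw [hqq, hqq, hqq, show j - 1 + σ 0 = j + σ 0 - 1 by ring,
      show j + 1 + σ 0 = j + σ 0 + 1 by ring, e2] at e1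
    have hne := h.ne0 (j + σ 0)
    have : (a (j + σ 0) - a' j) • q (j + σ 0) = 0 := by rw [sub_smul, e1, sub_self]
    rcases smul_eq_zero.1 this with h1 | h1
    · omega
    · exact absurd h1 hne

lemma uniq {a q a' q'} (h : Sq a q) (ha : ∀ i, 2 ≤ a i) (h' : Sq a' q') (ha' : ∀ i, 2 ≤ a' i)
    (S : ℤ × ℤ →+ ℤ × ℤ) (hS : ∀ u v, dt (S u) (S v) = dt u v)
    (n n' : ℕ) (hn : 1 ≤ n) (hn' : 1 ≤ n') (hq : ∀ i, S (q i) = q (i + n))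
    (hq' : ∀ i, S (q' i) = q' (i + n')) :
    n = n' ∧ ∃ s : ℤ, ∀ j, a' j = a (j + s) := by
  have hp : 0 < dt (q' 0) (S (q' 0)) := by
    rw [hq']; exact h'.pos ha' _ _ (by omega)
  rcases dich h S hS n hn hq _ hp with h1 | h1
  · exact uniq_pos h ha h' ha' S hS n n' hn hn' hq hq' h1
  · refine uniq_pos (q' := fun i => - q' i) h ha ⟨fun i => ?_, fun i => ?_⟩ ha' S hS n n' hn hn' hq
      (fun i => ?_) h1
    · rw [smul_neg, ← h'.r i]; abel
    · have := h'.d i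
      simp only [dt] at this
      simp [dt, this]
    · rw [map_neg, hq']

end CycU
namespace CycU

lemma exZ {X : Type*} (e : ℤ → X ≃ X) (x0 : X) :
    ∃ C : ℤ → X, C 0 = x0 ∧ ∀ i, C (i + 1) = e i (C i) := by
  let f : ℕ → X := fun k => Nat.rec x0 (fun k y => e k y) k
  let b : ℕ → X := fun k => Nat.rec x0 (fun k y => (e (-(k + 1))).symm y) k
  let C : ℤ → X := fun i => match i with
    | Int.ofNat k => f k
    | Int.negSucc k => b (k + 1)
  have hf : ∀ k : ℕ, C k = f k := fun k => rfl
  have hb : ∀ k : ℕ, C (-k) = b k := by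
    intro k
    cases k with
    | zero => rfl
    | succ k => rfl
  refine ⟨C, rfl, fun i => ?_⟩
  rcases Int.eq_nat_or_neg i with ⟨k, rfl | rfl⟩
  · exact hf (k + 1)
  · cases k with
    | zero => exact hf 1
    | succ k =>
      rw [hb, show (-((k + 1 : ℕ) : ℤ) + 1) = -(k : ℤ) by push_cast; ring, hb]
      change b k = e _ ((e (-(k + 1))).symm (b k))
      rw [show (-((k + 1 : ℕ) : ℤ)) = -((k : ℤ) + 1) by push_cast; ring]
      simp

lemma exR (A : ℤ → ℤ) (u v : ℤ × ℤ) : ∃ P : ℤ → ℤ × ℤ, P 0 = u ∧ P 1 = v ∧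
    ∀ i, P (i - 1) + P (i + 1) = A i • P i := by
  obtain ⟨C, h0, hC⟩ := exZ (X := (ℤ × ℤ) × (ℤ × ℤ)) (fun i =>
    { toFun := fun z => (z.2, A (i + 1) • z.2 - z.1)
      invFun := fun z => (A (i + 1) • z.1 - z.2, z.1)
      left_inv := fun z => by simp
      right_inv := fun z => by simp }) (u, v)
  have h1 : ∀ i, (C (i + 1)).1 = (C i).2 := fun i => by rw [hC]; rfl
  have h2 : ∀ i, (C (i + 1)).2 = A (i + 1) • (C i).2 - (C i).1 := fun i => by rw [hC]; rfl
  refine ⟨fun i => (C i).1, by simp [h0], ?_, fun i => ?_⟩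
  · have := h1 0
    simp only [zero_add] at this
    simp [this, h0]
  · have e1 := h1 (i - 1)
    have e2 := h2 (i - 1)
    have e3 := h1 i
    rw [sub_add_cancel] at e1 e2
    simp only
    rw [e3, e2, e1]
    abel

lemma uniqR {A : ℤ → ℤ} {P R : ℤ → ℤ × ℤ} (hP : ∀ i, P (i - 1) + P (i + 1) = A i • P i)
    (hR : ∀ i, R (i - 1) + R (i + 1) = A i • R i) (h0 : P 0 = R 0) (h1 : P 1 = R 1) (i : ℤ) :
    P i = R i := by
  suffices P i = R i ∧ P (i + 1) = R (i + 1) from this.1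
  induction i using Int.induction_on with
  | zero => exact ⟨h0, by simpa using h1⟩
  | succ i ih =>
    refine ⟨ih.2, ?_⟩
    have e1 := hP (i + 1)
    have e2 := hR (i + 1)
    rw [add_sub_cancel_right] at e1 e2
    rw [ih.1, ih.2, ← e2] at e1
    exact add_left_cancel e1
  | pred i ih =>
    rw [show (-i - 1 + 1 : ℤ) = -i by ring]
    refine ⟨?_, ih.1⟩
    have e1 := hP (-i)
    have e2 := hR (-i)
    rw [ih.1, ih.2, ← e2] at e1
    exact add_right_cancel e1

lemma constdet {A : ℤ → ℤ} {P : ℤ → ℤ × ℤ} (hP : ∀ i, P (i - 1) + P (i + 1) = A i • P i) (i : ℤ) :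
    dt (P i) (P (i + 1)) = dt (P 0) (P 1) := by
  have step : ∀ i, dt (P i) (P (i + 1)) = dt (P (i - 1)) (P i) := by
    intro i
    have e1 := congrArg Prod.fst (hP i)
    have e2 := congrArg Prod.snd (hP i)
    simp at e1 e2
    simp only [dt]
    linear_combination (P i).1 * e2 - (P i).2 * e1
  induction i using Int.induction_on with
  | zero => simp
  | succ i ih => rw [step, add_sub_cancel_right, ih]
  | pred i ih => rw [← ih, step (-i), sub_add_cancel]

lemma elim (k n : ℕ) (hn : 1 ≤ n) (A a : ℤ → ℤ) (P : ℤ → ℤ × ℤ) (hP : Sq A P)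
    (T : ℤ × ℤ →+ ℤ × ℤ) (hT : ∀ i, T (P i) = P (i + (2 * k + n : ℕ)))
    (hz : ∀ i : ℤ, 0 ≤ i → i < 2 * k → A i = 0) (ha : ∀ i, a (i + n) = a i)
    (hA : ∀ r : ℤ, 0 ≤ r → r < n → A (2 * k + r) = a r) :
    ∃ q, Sq a q ∧ ∀ i, ((-1 : ℤ) ^ k • T) (q i) = q (i + n) := by
  obtain ⟨q, q0, q1, hq⟩ := exR a (P (2 * k)) (P (2 * k + 1))
  have hm1 : q (-1) = P (2 * k - 1) := by
    have e1 := hq 0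
    have e2 := hP.r (2 * k)
    have e3 := hA 0 le_rfl (by omega)
    rw [add_zero] at e3
    rw [zero_add, zero_sub, q0, q1, ← e3, ← e2] at e1
    exact add_right_cancel e1
  have hr : ∀ r : ℕ, r ≤ n → q r = P (2 * k + r) ∧ q (r - 1) = P (2 * k + r - 1) := by
    intro r
    induction r with
    | zero => intro _; simp [q0, hm1]
    | succ r ih =>
      intro hr
      obtain ⟨i1, i2⟩ := ih (by omega)
      refine ⟨?_, ?_⟩
      · have e1 := hq r
        have e2 := hP.r (2 * k + r)
        rw [hA r (by omega) (by omega), ← i1, ← i2, ← e1] at e2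
        push_cast
        rw [← add_assoc]
        exact (add_left_cancel e2).symm
      · push_cast
        rw [add_sub_cancel_right, ← add_assoc, add_sub_cancel_right, i1]
  have hzz : ∀ j : ℕ, j ≤ k → P (2 * j) = (-1 : ℤ) ^ j • P 0 ∧
      P (2 * j - 1) = (-1 : ℤ) ^ j • P (-1) := by
    intro j
    induction j with
    | zero => simp
    | succ j ih =>
      intro hj
      obtain ⟨i1, i2⟩ := ih (by omega)
      have e1 := hP.r (2 * j)
      rw [hz _ (by omega) (by omega), zero_smul, i2] at e1
      have e2 := hP.r (2 * j + 1)
      rw [hz _ (by omega) (by omega), zero_smul, add_sub_cancel_right, i1] at e2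
      push_cast
      rw [show (2 * ((j : ℤ) + 1)) = 2 * j + 1 + 1 by ring, add_sub_cancel_right]
      refine ⟨?_, ?_⟩
      · rw [eq_neg_of_add_eq_zero_right e2, pow_succ]; simp
      · rw [eq_neg_of_add_eq_zero_right e1, pow_succ]; simp
  obtain ⟨z1, z2⟩ := hzz k le_rfl
  obtain ⟨r1, r2⟩ := hr n le_rfl
  have hsq : ((-1 : ℤ) ^ k) * (-1) ^ k = 1 := by rw [← mul_pow]; simp
  have s0 : ((-1 : ℤ) ^ k • T) (q 0) = q n := by
    rw [q0, z1, AddMonoidHom.smul_apply, map_zsmul, smul_smul, hsq, one_smul, hT, r1]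
    congr 1; push_cast; ring
  have s1 : ((-1 : ℤ) ^ k • T) (q (-1)) = q (n - 1) := by
    rw [hm1, z2, AddMonoidHom.smul_apply, map_zsmul, smul_smul, hsq, one_smul, hT, r2,
      show (-1 : ℤ) + (2 * k + n : ℕ) = 2 * k + n - 1 by push_cast; ring]
  refine ⟨q, ⟨hq, fun i => ?_⟩, fun i => ?_⟩
  · rw [constdet hq, q0, q1, hP.d]
  · have := uniqR (A := fun i => a (i - 1)) (P := fun i => ((-1 : ℤ) ^ k • T) (q (i - 1)))
      (R := fun i => q (i - 1 + n)) (fun i => ?_) (fun i => ?_) ?_ ?_ (i + 1)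
    · simpa using this
    · rw [← map_add, ← map_zsmul, ← hq]
      congr 3; ring
    · have := hq (i - 1 + n)
      rw [ha] at this
      rw [← this]
      congr 2 <;> ring
    · simp only [zero_sub, s1, show (-1 + n : ℤ) = n - 1 by ring]
    · simp [s0]

lemma smul_det (k : ℕ) (T : ℤ × ℤ →+ ℤ × ℤ) (hT : ∀ u v, dt (T u) (T v) = dt u v) (u v : ℤ × ℤ) :
    dt (((-1 : ℤ) ^ k • T) u) (((-1 : ℤ) ^ k • T) v) = dt u v := by
  rw [← hT u v]
  have hsq : ((-1 : ℤ) ^ k) * (-1) ^ k = 1 := by rw [← mul_pow]; simp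
  simp only [AddMonoidHom.smul_apply, dt, Prod.smul_fst, Prod.smul_snd, smul_eq_mul]
  linear_combination ((T u).1 * (T v).2 - (T u).2 * (T v).1) * hsq

/-- words level theorem -/
lemma words (k n n' : ℕ) (hn : 1 ≤ n) (hn' : 1 ≤ n') (A a A' a' : ℤ → ℤ) (P P' : ℤ → ℤ × ℤ)
    (hP : Sq A P) (hP' : Sq A' P')
    (T : ℤ × ℤ →+ ℤ × ℤ) (hdet : ∀ u v, dt (T u) (T v) = dt u v)
    (hT : ∀ i, T (P i) = P (i + (2 * k + n : ℕ)))
    (hT' : ∀ i, T (P' i) = P' (i + (2 * k + n' : ℕ)))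
    (hz : ∀ i : ℤ, 0 ≤ i → i < 2 * k → A i = 0) (ha : ∀ i, a (i + n) = a i)
    (hz' : ∀ i : ℤ, 0 ≤ i → i < 2 * k → A' i = 0) (ha' : ∀ i, a' (i + n') = a' i)
    (hA : ∀ r : ℤ, 0 ≤ r → r < n → A (2 * k + r) = a r)
    (hA' : ∀ r : ℤ, 0 ≤ r → r < n' → A' (2 * k + r) = a' r)
    (h2 : ∀ i, 2 ≤ a i) (h2' : ∀ i, 2 ≤ a' i) :
    n = n' ∧ ∃ s : ℤ, ∀ j, a' j = a (j + s) := by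
  obtain ⟨q, hq, hqS⟩ := elim k n hn A a P hP T hT hz ha hA
  obtain ⟨q', hq', hqS'⟩ := elim k n' hn' A' a' P' hP' T hT' hz' ha' hA'
  exact uniq hq h2 hq' h2' _ (smul_det k T hdet) n n' hn hn' hqS hqS'

end CycU
namespace CycU
open WGraph

/-- neighbours -/
def nb (G : WGraph) (v : ℕ) : Finset ℕ := G.verts.filter (fun u => G.adj v u = true)

lemma mem_nb {G : WGraph} {v u : ℕ} : u ∈ nb G v ↔ G.adj v u = true := by
  simp only [nb, Finset.mem_filter, and_iff_right_iff_imp]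
  exact fun h => (G.support _ _ h).2

lemma adj_ne {G : WGraph} {u v : ℕ} (h : G.adj u v = true) : u ≠ v := by
  rintro rfl; simp [G.loopless] at h

lemma in_facts {G G' : WGraph} {u v x : ℕ} (h : IsInnerBlowup G G' u v x) :
    u ≠ v ∧ u ≠ x ∧ v ≠ x ∧ u ∈ G.verts ∧ v ∈ G.verts ∧ x ∉ G.verts := by
  obtain ⟨h1, h2, -⟩ := h
  obtain ⟨hu, hv⟩ := G.support _ _ h1
  exact ⟨adj_ne h1, fun e => h2 (e ▸ hu), fun e => h2 (e ▸ hv), hu, hv, h2⟩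

lemma nb_sub {G : WGraph} {a b : ℕ} (h : b ∈ nb G a) : b ∈ G.verts :=
  (G.support _ _ (mem_nb.1 h)).2

lemma in_nb_u {G G' : WGraph} {u v x : ℕ} (h : IsInnerBlowup G G' u v x) :
    nb G' u = insert x ((nb G u).erase v) := by
  obtain ⟨f1, f2, f3, f4, f5, f6⟩ := in_facts h
  ext b
  rw [mem_nb, h.2.2.2.1]
  simp only [Finset.mem_insert, Finset.mem_erase, mem_nb]
  have := h.1
  by_cases hb : b = v
  · subst hb; simp [*]
  · simp [*]; tauto

lemma in_nb_v {G G' : WGraph} {u v x : ℕ} (h : IsInnerBlowup G G' u v x) :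
    nb G' v = insert x ((nb G v).erase u) := by
  obtain ⟨f1, f2, f3, f4, f5, f6⟩ := in_facts h
  ext b
  rw [mem_nb, h.2.2.2.1]
  simp only [Finset.mem_insert, Finset.mem_erase, mem_nb]
  by_cases hb : b = u
  · subst hb; simp [*, Ne.symm f1]
  · simp [*, Ne.symm f1]; tauto

lemma in_nb_x {G G' : WGraph} {u v x : ℕ} (h : IsInnerBlowup G G' u v x) :
    nb G' x = {u, v} := by
  obtain ⟨f1, f2, f3, f4, f5, f6⟩ := in_facts h
  ext b
  rw [mem_nb, h.2.2.2.1]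
  have : G.adj x b ≠ true := fun e => f6 (G.support _ _ e).1
  simp [this, Ne.symm f2, Ne.symm f3]

lemma in_nb_o {G G' : WGraph} {u v x : ℕ} (h : IsInnerBlowup G G' u v x) {a : ℕ}
    (hu : a ≠ u) (hv : a ≠ v) (hx : a ≠ x) : nb G' a = nb G a := by
  ext b
  rw [mem_nb, h.2.2.2.1, mem_nb]
  simp [hu, hv, hx]

lemma out_nb_v {G G' : WGraph} {v x : ℕ} (h : IsOuterBlowup G G' v x) :
    nb G' v = insert x (nb G v) := by
  have : v ≠ x := fun e => h.2.1 (e ▸ h.1)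
  ext b
  rw [mem_nb, h.2.2.2.1]
  simp [mem_nb, this]; tauto

lemma out_nb_x {G G' : WGraph} {v x : ℕ} (h : IsOuterBlowup G G' v x) :
    nb G' x = {v} := by
  have : v ≠ x := fun e => h.2.1 (e ▸ h.1)
  ext b
  rw [mem_nb, h.2.2.2.1]
  have h2 : G.adj x b ≠ true := fun e => h.2.1 (G.support _ _ e).1
  simp [h2, this.symm]

lemma out_nb_o {G G' : WGraph} {v x : ℕ} (h : IsOuterBlowup G G' v x) {a : ℕ}
    (hv : a ≠ v) (hx : a ≠ x) : nb G' a = nb G a := by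
  ext b
  rw [mem_nb, h.2.2.2.1, mem_nb]
  simp [hv, hx]

section
variable {A : Type*} [AddCommGroup A]

lemma in_sum_u {G G' : WGraph} {u v x : ℕ} (h : IsInnerBlowup G G' u v x) (F : ℕ → A) :
    ∑ b ∈ nb G' u, F b = F x + ∑ b ∈ (nb G u).erase v, F b := by
  obtain ⟨f1, f2, f3, f4, f5, f6⟩ := in_facts h
  rw [in_nb_u h, Finset.sum_insert]
  intro hx; exact f6 (nb_sub (Finset.mem_of_mem_erase hx))

lemma in_sum_v {G G' : WGraph} {u v x : ℕ} (h : IsInnerBlowup G G' u v x) (F : ℕ → A) :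
    ∑ b ∈ nb G' v, F b = F x + ∑ b ∈ (nb G v).erase u, F b := by
  obtain ⟨f1, f2, f3, f4, f5, f6⟩ := in_facts h
  rw [in_nb_v h, Finset.sum_insert]
  intro hx; exact f6 (nb_sub (Finset.mem_of_mem_erase hx))

lemma in_sum_u0 {G G' : WGraph} {u v x : ℕ} (h : IsInnerBlowup G G' u v x) (F : ℕ → A) :
    ∑ b ∈ nb G u, F b = F v + ∑ b ∈ (nb G u).erase v, F b :=
  (Finset.add_sum_erase _ _ (mem_nb.2 h.1)).symm

lemma in_sum_v0 {G G' : WGraph} {u v x : ℕ} (h : IsInnerBlowup G G' u v x) (F : ℕ → A) :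
    ∑ b ∈ nb G v, F b = F u + ∑ b ∈ (nb G v).erase u, F b :=
  (Finset.add_sum_erase _ _ (mem_nb.2 (G.symm _ _ h.1))).symm

lemma in_sum_x {G G' : WGraph} {u v x : ℕ} (h : IsInnerBlowup G G' u v x) (F : ℕ → A) :
    ∑ b ∈ nb G' x, F b = F u + F v := by
  rw [in_nb_x h, Finset.sum_pair (in_facts h).1]

lemma out_sum_v {G G' : WGraph} {v x : ℕ} (h : IsOuterBlowup G G' v x) (F : ℕ → A) :
    ∑ b ∈ nb G' v, F b = F x + ∑ b ∈ nb G v, F b := by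
  rw [out_nb_v h, Finset.sum_insert]
  intro hx; exact h.2.1 (nb_sub hx)

lemma dsum_in {G G' : WGraph} {u v x : ℕ} (h : IsInnerBlowup G G' u v x) (F : ℕ → ℕ → A) :
    ∑ a ∈ G'.verts, ∑ b ∈ nb G' a, F a b =
      ∑ a ∈ G.verts, ∑ b ∈ nb G a, F a b - F u v - F v u + F u x + F v x + F x u + F x v := by
  obtain ⟨f1, f2, f3, f4, f5, f6⟩ := in_facts h
  rw [h.2.2.1, Finset.sum_insert f6, in_sum_x h]
  have e : ∀ a ∈ G.verts, ∑ b ∈ nb G' a, F a b = ∑ b ∈ nb G a, F a b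
      + ((if a = u then F u x - F u v else 0) + if a = v then F v x - F v u else 0) := by
    intro a ha
    by_cases hu : a = u
    · subst hu
      rw [in_sum_u h, in_sum_u0 h]; simp [f1]; abel
    · by_cases hv : a = v
      · subst hv
        rw [in_sum_v h, in_sum_v0 h]; simp [hu]; abel
      · rw [in_nb_o h hu hv (fun e => f6 (e ▸ ha))]; simp [hu, hv]
  rw [Finset.sum_congr rfl e, Finset.sum_add_distrib, Finset.sum_add_distrib,
    Finset.sum_ite_eq', Finset.sum_ite_eq', if_pos f4, if_pos f5]
  abel

lemma dsum_out {G G' : WGraph} {v x : ℕ} (h : IsOuterBlowup G G' v x) (F : ℕ → ℕ → A) :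
    ∑ a ∈ G'.verts, ∑ b ∈ nb G' a, F a b =
      ∑ a ∈ G.verts, ∑ b ∈ nb G a, F a b + F v x + F x v := by
  have f6 := h.2.1
  rw [h.2.2.1, Finset.sum_insert f6, out_nb_x h, Finset.sum_singleton]
  have e : ∀ a ∈ G.verts, ∑ b ∈ nb G' a, F a b = ∑ b ∈ nb G a, F a b
      + (if a = v then F v x else 0) := by
    intro a ha
    by_cases hv : a = v
    · subst hv
      rw [out_sum_v h]; simp [add_comm]
    · rw [out_nb_o h hv (fun e => f6 (e ▸ ha))]; simp [hv]
  rw [Finset.sum_congr rfl e, Finset.sum_add_distrib, Finset.sum_ite_eq', if_pos h.1]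
  abel

lemma iso_nb {G G' : WGraph} {f : ℕ → ℕ} (hb : Set.BijOn f (G.verts : Set ℕ) (G'.verts : Set ℕ))
    (ha : ∀ u ∈ G.verts, ∀ v ∈ G.verts, G'.adj (f u) (f v) = G.adj u v) {v : ℕ} (hv : v ∈ G.verts)
    (F : ℕ → A) : ∑ b ∈ nb G' (f v), F b = ∑ b ∈ nb G v, F (f b) := by
  symm
  refine Finset.sum_bij (fun b _ => f b) ?_ ?_ ?_ (fun _ _ => rfl)
  · intro b hbm
    rw [mem_nb, ha v hv b (nb_sub hbm)]; exact mem_nb.1 hbm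
  · intro a h1 b h2 e
    exact hb.injOn (by simpa using nb_sub h1) (by simpa using nb_sub h2) e
  · intro b hbm
    obtain ⟨a, ha1, rfl⟩ := hb.surjOn (by simpa using nb_sub hbm)
    refine ⟨a, ?_, rfl⟩
    rw [mem_nb, ← ha v hv a (by simpa using ha1)]; exact mem_nb.1 hbm

lemma iso_sum {G G' : WGraph} {f : ℕ → ℕ} (hb : Set.BijOn f (G.verts : Set ℕ) (G'.verts : Set ℕ))
    (F : ℕ → A) : ∑ b ∈ G'.verts, F b = ∑ b ∈ G.verts, F (f b) := by
  symm
  refine Finset.sum_bij (fun b _ => f b) ?_ ?_ ?_ (fun _ _ => rfl)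
  · intro b hbm; exact hb.mapsTo hbm
  · intro a h1 b h2 e
    exact hb.injOn h1 h2 e
  · intro b hbm
    obtain ⟨a, ha1, rfl⟩ := hb.surjOn hbm
    exact ⟨a, ha1, rfl⟩

end

lemma iso_symm {G G' : WGraph} (h : WIso G G') : WIso G' G := by
  obtain ⟨f, hb, ha, hw⟩ := h
  have hg := hb.invOn_invFunOn
  refine ⟨Function.invFunOn f G.verts, hb.symm hg.symm, ?_, ?_⟩
  · intro u hu v hv
    have h1 := hb.surjOn.mapsTo_invFunOn hu
    have h2 := hb.surjOn.mapsTo_invFunOn hv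
    rw [← ha _ h1 _ h2, hg.2 hu, hg.2 hv]
  · intro v hv
    have h2 := hb.surjOn.mapsTo_invFunOn hv
    rw [← hw _ h2, hg.2 hv]

/- quadratic form -/
def QF (G : WGraph) (f : ℕ → ℝ) : ℝ :=
  ∑ v ∈ G.verts, (G.wt v : ℝ) * f v ^ 2 + ∑ v ∈ G.verts, ∑ u ∈ nb G v, f v * f u

lemma QF_in {G G' : WGraph} {u v x : ℕ} (h : IsInnerBlowup G G' u v x) (f : ℕ → ℝ) :
    QF G' f = QF G f - (f x - f u - f v) ^ 2 := by
  obtain ⟨f1, f2, f3, f4, f5, f6⟩ := in_facts h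
  rw [QF, dsum_in h, QF, h.2.2.1, Finset.sum_insert f6]
  have e : ∀ a ∈ G.verts, (G'.wt a : ℝ) * f a ^ 2 = G.wt a * f a ^ 2
      + ((if a = u then - f u ^ 2 else 0) + if a = v then - f v ^ 2 else 0) := by
    intro a ha
    have hx : a ≠ x := fun e => f6 (e ▸ ha)
    rw [h.2.2.2.2]
    by_cases hu : a = u
    · subst hu; simp [hx, f1]; ring
    · by_cases hv : a = v
      · subst hv; simp [hx, hu]; ring
      · simp [hx, hu, hv]
  rw [Finset.sum_congr rfl e, Finset.sum_add_distrib, Finset.sum_add_distrib,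
    Finset.sum_ite_eq', Finset.sum_ite_eq', if_pos f4, if_pos f5, h.2.2.2.2]
  simp
  ring

lemma QF_out {G G' : WGraph} {v x : ℕ} (h : IsOuterBlowup G G' v x) (f : ℕ → ℝ) :
    QF G' f = QF G f - (f x - f v) ^ 2 := by
  have f6 := h.2.1
  rw [QF, dsum_out h, QF, h.2.2.1, Finset.sum_insert f6]
  have e : ∀ a ∈ G.verts, (G'.wt a : ℝ) * f a ^ 2 = G.wt a * f a ^ 2
      + (if a = v then - f v ^ 2 else 0) := by
    intro a ha
    have hx : a ≠ x := fun e => f6 (e ▸ ha)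
    rw [h.2.2.2.2]
    by_cases hv : a = v
    · subst hv; simp [hx]; ring
    · simp [hx, hv]
  rw [Finset.sum_congr rfl e, Finset.sum_add_distrib, 
    Finset.sum_ite_eq', if_pos h.1, h.2.2.2.2]
  simp
  ring

lemma QF_congr {G : WGraph} {f g : ℕ → ℝ} (h : ∀ v ∈ G.verts, f v = g v) : QF G f = QF G g := by
  unfold QF
  congr 1
  · exact Finset.sum_congr rfl fun v hv => by rw [h v hv]
  · exact Finset.sum_congr rfl fun v hv => Finset.sum_congr rfl fun u hu => by
      rw [h v hv, h u (nb_sub hu)]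

def PosDim (d : ℕ) (G : WGraph) : Prop :=
  ∃ φ : (Fin d → ℝ) →ₗ[ℝ] (ℕ → ℝ), ∀ a, a ≠ 0 → 0 < QF G (φ a)

/-- replace the value at `x` by the sum of the values over `s` -/
noncomputable def updL (x : ℕ) (s : Finset ℕ) : (ℕ → ℝ) →ₗ[ℝ] (ℕ → ℝ) where
  toFun f := fun a => if a = x then ∑ b ∈ s, f b else f a
  map_add' f g := by
    ext a
    by_cases h : a = x <;> simp [h, Finset.sum_add_distrib]
  map_smul' c f := by
    ext a
    by_cases h : a = x <;> simp [h, Finset.mul_sum]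

lemma PosDim_step {G G' : WGraph} (h : BlowupStep G G') (d : ℕ) : PosDim d G ↔ PosDim d G' := by
  rcases h with ⟨u, v, x, h⟩ | ⟨v, x, h⟩
  · obtain ⟨f1, f2, f3, f4, f5, f6⟩ := in_facts h
    constructor
    · rintro ⟨φ, hφ⟩
      refine ⟨(updL x {u, v}).comp φ, fun a ha => ?_⟩
      rw [QF_in h]
      have e : QF G ((updL x {u, v}).comp φ a) = QF G (φ a) := QF_congr fun w hw => by
        have : w ≠ x := fun e => f6 (e ▸ hw)
        simp [updL, this]
      rw [e]
      have := hφ a ha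
      simp [updL, f2, f3, Finset.sum_pair f1, this]
    · rintro ⟨φ, hφ⟩
      refine ⟨φ, fun a ha => ?_⟩
      have := hφ a ha
      rw [QF_in h] at this
      nlinarith [sq_nonneg (φ a x - φ a u - φ a v)]
  · have f6 := h.2.1
    have f2 : v ≠ x := fun e => f6 (e ▸ h.1)
    constructor
    · rintro ⟨φ, hφ⟩
      refine ⟨(updL x {v}).comp φ, fun a ha => ?_⟩
      rw [QF_out h]
      have e : QF G ((updL x {v}).comp φ a) = QF G (φ a) := QF_congr fun w hw => by
        have : w ≠ x := fun e => f6 (e ▸ hw)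
        simp [updL, this]
      rw [e]
      have := hφ a ha
      simp [updL, f2, this]
    · rintro ⟨φ, hφ⟩
      refine ⟨φ, fun a ha => ?_⟩
      have := hφ a ha
      rw [QF_out h] at this
      nlinarith [sq_nonneg (φ a x - φ a v)]

lemma PosDim_iso {G G' : WGraph} (h : WIso G G') (d : ℕ) (hp : PosDim d G') : PosDim d G := by
  obtain ⟨f, hb, ha, hw⟩ := h
  obtain ⟨φ, hφ⟩ := hp
  refine ⟨(LinearMap.funLeft ℝ ℝ f).comp φ, fun a hane => ?_⟩
  have := hφ a hane
  convert this using 1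
  rw [QF, QF, iso_sum hb, iso_sum hb]
  congr 1
  · exact Finset.sum_congr rfl fun v hv => by simp [hw v hv, LinearMap.funLeft]
  · exact Finset.sum_congr rfl fun v hv => by rw [iso_nb hb ha hv]; simp [LinearMap.funLeft]

lemma inv_birEq {R : WGraph → Prop} (h1 : ∀ G G', BlowupStep G G' → (R G ↔ R G'))
    (h2 : ∀ G G', WIso G G' → R G' → R G) {G G' : WGraph} (h : BirEq G G') : R G ↔ R G' := by
  induction h with
  | rel G G' h =>
    rcases h with (h | h) | h
    · exact h1 _ _ h
    · exact (h1 _ _ h).symm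
    · exact ⟨h2 _ _ (iso_symm h), h2 _ _ h⟩
  | refl => rfl
  | symm _ _ _ ih => exact ih.symm
  | trans _ _ _ _ _ i1 i2 => exact i1.trans i2

end CycU
namespace CycU
open WGraph

structure Dat (T : ℤ × ℤ →+ ℤ × ℤ) (G : WGraph) (c : ℕ → ℕ → ℤ) (p : ℕ → ℤ → ℤ × ℤ) : Prop where
  anti : ∀ u v, c u v = - c v u
  sh : ∀ v s, p v (s + 1) = T (p v s)
  eq : ∀ v ∈ G.verts, ∀ s, G.wt v • p v s + ∑ u ∈ nb G v, p u (s + c v u) = 0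
  fl : ∑ v ∈ G.verts, ∑ u ∈ nb G v, c v u * dt (p v 0) (p u (c v u)) = 2

lemma Dat.dtsh {T G c p} (h : Dat T G c p) (hT : ∀ u v, dt (T u) (T v) = dt u v)
    (u v : ℕ) (s t m : ℤ) : dt (p u (s + m)) (p v (t + m)) = dt (p u s) (p v t) := by
  have step : ∀ s t, dt (p u (s + 1)) (p v (t + 1)) = dt (p u s) (p v t) := by
    intro s t; rw [h.sh, h.sh, hT]
  induction m using Int.induction_on with
  | zero => simp
  | succ m ih => rw [← add_assoc, ← add_assoc, step, ih]
  | pred m ih =>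
    rw [← ih, ← step, show s + (-m - 1) + 1 = s + -m by ring, show t + (-m - 1) + 1 = t + -m by ring]

def QT (T : ℤ × ℤ →+ ℤ × ℤ) (G : WGraph) : Prop := ∃ c p, Dat T G c p

lemma dt_self (u : ℤ × ℤ) : dt u u = 0 := by simp only [dt]; ring

lemma dt_addr (u v w : ℤ × ℤ) : dt u (v + w) = dt u v + dt u w := by
  simp [dt]; ring

lemma dt_addl (u v w : ℤ × ℤ) : dt (v + w) u = dt v u + dt w u := by
  simp [dt]; ring

/-- Core of the inner blowup: the data agree away from `x` and the edge `uv`. -/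
lemma in_core {T : ℤ × ℤ →+ ℤ × ℤ} (hT : ∀ u v, dt (T u) (T v) = dt u v)
    {G G' : WGraph} {u v x : ℕ} (h : IsInnerBlowup G G' u v x)
    (c c' : ℕ → ℕ → ℤ) (p p' : ℕ → ℤ → ℤ × ℤ)
    (anti : ∀ u v, c u v = - c v u) (anti' : ∀ u v, c' u v = - c' v u)
    (sh : ∀ v s, p v (s + 1) = T (p v s)) (sh' : ∀ v s, p' v (s + 1) = T (p' v s))
    (hp : ∀ a ∈ G.verts, p' a = p a)
    (hc : ∀ a ∈ G.verts, ∀ b ∈ G.verts, ¬ (a = u ∧ b = v) → ¬ (a = v ∧ b = u) → c' a b = c a b)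
    (hcx : c u v = c' u x + c' x v)
    (hpx : ∀ s, p' x s = p u (s + c' x u) + p v (s + c' x v)) :
    Dat T G c p ↔ Dat T G' c' p' := by
  obtain ⟨f1, f2, f3, f4, f5, f6⟩ := in_facts h
  have hu := hp u f4
  have hv := hp v f5
  have a1 := anti' u x
  have a2 := anti' v x
  have a3 := anti v u
  -- equations
  have eqx : ∀ s, G'.wt x • p' x s + ∑ b ∈ nb G' x, p' b (s + c' x b) = 0 := by
    intro s
    rw [in_sum_x h, h.2.2.2.2, hpx, hu, hv]
    simp
    abel
  have equ : ∀ s, G'.wt u • p' u s + ∑ b ∈ nb G' u, p' b (s + c' u b)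
      = G.wt u • p u s + ∑ b ∈ nb G u, p b (s + c u b) := by
    intro s
    rw [in_sum_u h, in_sum_u0 h, h.2.2.2.2, hpx, hu]
    have e : ∑ b ∈ (nb G u).erase v, p' b (s + c' u b) = ∑ b ∈ (nb G u).erase v, p b (s + c u b) := by
      refine Finset.sum_congr rfl fun b hb => ?_
      have hb' := Finset.mem_erase.1 hb
      rw [hp b (nb_sub hb'.2), hc u f4 b (nb_sub hb'.2) (fun e => hb'.1 e.2) (fun e => f1 e.1)]
    rw [e, show s + c' u x + c' x u = s by omega, show s + c' u x + c' x v = s + c u v by omega]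
    simp only [f2, if_false, if_true, sub_smul, one_smul]
    abel
  have eqv : ∀ s, G'.wt v • p' v s + ∑ b ∈ nb G' v, p' b (s + c' v b)
      = G.wt v • p v s + ∑ b ∈ nb G v, p b (s + c v b) := by
    intro s
    rw [in_sum_v h, in_sum_v0 h, h.2.2.2.2, hpx, hv]
    have e : ∑ b ∈ (nb G v).erase u, p' b (s + c' v b) = ∑ b ∈ (nb G v).erase u, p b (s + c v b) := by
      refine Finset.sum_congr rfl fun b hb => ?_
      have hb' := Finset.mem_erase.1 hb
      rw [hp b (nb_sub hb'.2), hc v f5 b (nb_sub hb'.2) (fun e => f1 e.1.symm) (fun e => hb'.1 e.2)]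
    rw [e, show s + c' v x + c' x v = s by omega, show s + c' v x + c' x u = s + c v u by omega]
    simp only [f3, f1.symm, if_false, if_true, sub_smul, one_smul]
    abel
  have eqo : ∀ a ∈ G.verts, a ≠ u → a ≠ v → ∀ s,
      G'.wt a • p' a s + ∑ b ∈ nb G' a, p' b (s + c' a b)
      = G.wt a • p a s + ∑ b ∈ nb G a, p b (s + c a b) := by
    intro a ha hau hav s
    have hax : a ≠ x := fun e => f6 (e ▸ ha)
    rw [in_nb_o h hau hav hax, h.2.2.2.2, hp a ha]
    simp only [hau, hav, hax, if_false]
    congr 1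
    refine Finset.sum_congr rfl fun b hb => ?_
    rw [hp b (nb_sub hb), hc a ha b (nb_sub hb) (fun e => hau e.1) (fun e => hav e.1)]
  have eqall : ∀ a ∈ G.verts, ∀ s, G'.wt a • p' a s + ∑ b ∈ nb G' a, p' b (s + c' a b)
      = G.wt a • p a s + ∑ b ∈ nb G a, p b (s + c a b) := by
    intro a ha s
    by_cases hau : a = u
    · subst hau; exact equ s
    · by_cases hav : a = v
      · subst hav; exact eqv s
      · exact eqo a ha hau hav s
  -- flux
  have dts : ∀ (a b : ℕ) (s t m : ℤ), dt (p a (s + m)) (p b (t + m)) = dt (p a s) (p b t) := by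
    intro a b s t m
    have step : ∀ s t, dt (p a (s + 1)) (p b (t + 1)) = dt (p a s) (p b t) := by
      intro s t; rw [sh, sh, hT]
    induction m using Int.induction_on with
    | zero => simp
    | succ m ih => rw [← add_assoc, ← add_assoc, step, ih]
    | pred m ih =>
      rw [← ih, ← step, show s + (-m - 1) + 1 = s + -m by ring, show t + (-m - 1) + 1 = t + -m by ring]
  have J1 : dt (p' u 0) (p' x (c' u x)) = dt (p u 0) (p v (c u v)) := by
    rw [hpx, hu, dt_addr, show c' u x + c' x u = 0 by omega, dt_self, hcx, zero_add]
  have J2 : dt (p' x 0) (p' u (c' x u)) = - dt (p u 0) (p v (c u v)) := by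
    rw [hpx, hu, zero_add, zero_add, dt_addl, dt_self, dt_anti (p v _), zero_add,
      ← dts u v (c' x u) (c' x v) (c' u x), show c' x u + c' u x = 0 by omega,
      show c' x v + c' u x = c u v by omega]
  have J3 : dt (p' x 0) (p' v (c' x v)) = dt (p u 0) (p v (c u v)) := by
    rw [hpx, hv, zero_add, zero_add, dt_addl, dt_self, add_zero,
      ← dts u v (c' x u) (c' x v) (c' u x), show c' x u + c' u x = 0 by omega,
      show c' x v + c' u x = c u v by omega]
  have J4 : dt (p' v 0) (p' x (c' v x)) = - dt (p u 0) (p v (c u v)) := by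
    rw [hpx, hv, dt_addr, show c' v x + c' x v = 0 by omega, dt_self, add_zero,
      dt_anti, ← dts u v _ 0 (c u v), zero_add, show c' v x + c' x u + c u v = 0 by omega]
  have J5 : dt (p v 0) (p u (c v u)) = - dt (p u 0) (p v (c u v)) := by
    rw [dt_anti, ← dts u v _ 0 (c u v), zero_add, show c v u + c u v = 0 by omega]
  have fl : ∑ a ∈ G'.verts, ∑ b ∈ nb G' a, c' a b * dt (p' a 0) (p' b (c' a b))
      = ∑ a ∈ G.verts, ∑ b ∈ nb G a, c a b * dt (p a 0) (p b (c a b)) := by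
    have k := dsum_in h (fun a b => if a = u ∧ b = v then 0 else if a = v ∧ b = u then 0 else
      c' a b * dt (p' a 0) (p' b (c' a b)))
    have k2 := dsum_in h (fun a b => (if a = u ∧ b = v then c u v * dt (p u 0) (p v (c u v)) else 0)
      + if a = v ∧ b = u then c v u * dt (p v 0) (p u (c v u)) else 0)
    have e1 : ∑ a ∈ G'.verts, ∑ b ∈ nb G' a, c' a b * dt (p' a 0) (p' b (c' a b))
      = ∑ a ∈ G'.verts, ∑ b ∈ nb G' a, (if a = u ∧ b = v then 0 else if a = v ∧ b = u then 0 else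
      c' a b * dt (p' a 0) (p' b (c' a b))) := by
      refine Finset.sum_congr rfl fun a _ => Finset.sum_congr rfl fun b hb => ?_
      have hb := mem_nb.1 hb
      rw [h.2.2.2.1] at hb
      rw [if_neg, if_neg]
      · rintro ⟨rfl, rfl⟩; simp [f1, f2, f3] at hb
      · rintro ⟨rfl, rfl⟩; simp [f1, f2, f3] at hb
    have e2 : ∑ a ∈ G'.verts, ∑ b ∈ nb G' a,
        ((if a = u ∧ b = v then c u v * dt (p u 0) (p v (c u v)) else 0)
      + if a = v ∧ b = u then c v u * dt (p v 0) (p u (c v u)) else 0) = 0 := by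
      refine Finset.sum_eq_zero fun a _ => Finset.sum_eq_zero fun b hb => ?_
      have hb := mem_nb.1 hb
      rw [h.2.2.2.1] at hb
      rw [if_neg, if_neg, add_zero]
      · rintro ⟨rfl, rfl⟩; simp [f1, f2, f3] at hb
      · rintro ⟨rfl, rfl⟩; simp [f1, f2, f3] at hb
    have e3 : ∑ a ∈ G.verts, ∑ b ∈ nb G a, c a b * dt (p a 0) (p b (c a b))
      = ∑ a ∈ G.verts, ∑ b ∈ nb G a, (if a = u ∧ b = v then 0 else if a = v ∧ b = u then 0 else
        c' a b * dt (p' a 0) (p' b (c' a b))) + ∑ a ∈ G.verts, ∑ b ∈ nb G a, 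
        ((if a = u ∧ b = v then c u v * dt (p u 0) (p v (c u v)) else 0)
      + if a = v ∧ b = u then c v u * dt (p v 0) (p u (c v u)) else 0) := by
      rw [← Finset.sum_add_distrib]
      refine Finset.sum_congr rfl fun a ha => ?_
      rw [← Finset.sum_add_distrib]
      refine Finset.sum_congr rfl fun b hb => ?_
      by_cases c1 : a = u ∧ b = v
      · obtain ⟨rfl, rfl⟩ := c1
        simp [f1]
      · by_cases c2 : a = v ∧ b = u
        · obtain ⟨rfl, rfl⟩ := c2
          simp [f1.symm]
        · simp only [c1, c2, if_false, add_zero]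
          rw [hc a ha b (nb_sub hb) c1 c2, hp a ha, hp b (nb_sub hb)]
    rw [e2] at k2
    rw [e1, k, e3]
    simp [f1, f1.symm, f2, f2.symm, f3, f3.symm] at k2
    simp only [f1, f1.symm, f2, f2.symm, f3, f3.symm, J1, J2, J3, J4, and_true, true_and, and_false,
      false_and, and_self, if_true, if_false]
    rw [J5] at k2
    simp only [J5]
    have q1 : c' x u = - c' u x := by omega
    have q2 : c' v x = - c' x v := by omega
    rw [q1, q2]
    rw [hcx] at k2 ⊢
    rw [a3, hcx] at k2
    rw [a3, hcx]
    linear_combination k2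
  constructor
  · intro H
    refine ⟨anti', sh', ?_, fl.trans H.fl⟩
    rw [h.2.2.1]
    intro a ha s
    rcases Finset.mem_insert.1 ha with rfl | ha
    · exact eqx s
    · rw [eqall a ha]; exact H.eq a ha s
  · intro H
    refine ⟨anti, sh, fun a ha s => ?_, fl.symm.trans H.fl⟩
    rw [← eqall a ha]
    exact H.eq a (by rw [h.2.2.1]; exact Finset.mem_insert_of_mem ha) s

lemma QT_in {T : ℤ × ℤ →+ ℤ × ℤ} (hT : ∀ u v, dt (T u) (T v) = dt u v)
    {G G' : WGraph} {u v x : ℕ} (h : IsInnerBlowup G G' u v x) : QT T G ↔ QT T G' := by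
  obtain ⟨f1, f2, f3, f4, f5, f6⟩ := in_facts h
  constructor
  · rintro ⟨c, p, H⟩
    refine ⟨fun a b => if a = x then (if b = v then c u v else 0) else
        if b = x then (if a = v then - c u v else 0) else c a b,
      fun a => if a = x then (fun s => p u s + p v (s + c u v)) else p a, ?_⟩
    refine (in_core hT h c _ p _ H.anti ?_ H.sh ?_ ?_ ?_ ?_ ?_).1 H
    · intro a b
      by_cases ha : a = x <;> by_cases hb : b = x
      · subst ha; subst hb; simp [f3.symm]
      · subst ha; simp [hb]; split_ifs <;> simp
      · subst hb; simp [ha]; split_ifs <;> simp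
      · simp [ha, hb]; exact H.anti a b
    · intro a s
      by_cases ha : a = x
      · simp only [ha, if_true]
        rw [H.sh, map_add, ← H.sh, ← H.sh]; congr 2; ring
      · simp only [ha, if_false]; exact H.sh a s
    · intro a ha
      have hax : a ≠ x := fun e => f6 (e ▸ ha)
      simp [hax]
    · intro a ha b hb _ _
      have hax : a ≠ x := fun e => f6 (e ▸ ha)
      have hbx : b ≠ x := fun e => f6 (e ▸ hb)
      simp [hax, hbx]
    · simp [f1, f2]
    · intro s; simp [f1]
  · rintro ⟨c', p', H⟩
    refine ⟨fun a b => if a = u ∧ b = v then c' u x + c' x v else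
        if a = v ∧ b = u then -(c' u x + c' x v) else c' a b, p', ?_⟩
    refine (in_core hT h _ c' p' p' ?_ H.anti H.sh H.sh ?_ ?_ ?_ ?_).2 H
    · intro a b
      by_cases c1 : a = u ∧ b = v
      · obtain ⟨rfl, rfl⟩ := c1
        simp [f1]
      · by_cases c2 : a = v ∧ b = u
        · obtain ⟨rfl, rfl⟩ := c2
          simp [f1.symm]
        · have c3 : ¬ (b = u ∧ a = v) := fun e => c2 e.symm
          have c4 : ¬ (b = v ∧ a = u) := fun e => c1 e.symm
          simp only [c1, c2, c3, c4, if_false]; exact H.anti a b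
    · intro a _; rfl
    · intro a _ b _ c1 c2
      simp [c1, c2]
    · simp
    · intro s
      have := H.eq x (by rw [h.2.2.1]; exact Finset.mem_insert_self _ _) s
      rw [in_sum_x h, h.2.2.2.2] at this
      simp at this
      rw [neg_add_eq_zero] at this
      exact this

lemma out_core {T : ℤ × ℤ →+ ℤ × ℤ}
    {G G' : WGraph} {v x : ℕ} (h : IsOuterBlowup G G' v x)
    (c c' : ℕ → ℕ → ℤ) (p p' : ℕ → ℤ → ℤ × ℤ)
    (anti : ∀ u v, c u v = - c v u) (anti' : ∀ u v, c' u v = - c' v u)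
    (sh : ∀ v s, p v (s + 1) = T (p v s)) (sh' : ∀ v s, p' v (s + 1) = T (p' v s))
    (hp : ∀ a ∈ G.verts, p' a = p a)
    (hc : ∀ a ∈ G.verts, ∀ b ∈ G.verts, c' a b = c a b)
    (hpx : ∀ s, p' x s = p v (s + c' x v)) :
    Dat T G c p ↔ Dat T G' c' p' := by
  have f6 := h.2.1
  have f3 : v ≠ x := fun e => f6 (e ▸ h.1)
  have hv := hp v h.1
  have a2 := anti' v x
  have eqx : ∀ s, G'.wt x • p' x s + ∑ b ∈ nb G' x, p' b (s + c' x b) = 0 := by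
    intro s
    rw [out_nb_x h, h.2.2.2.2, hpx]
    simp [hv]
  have eqall : ∀ a ∈ G.verts, ∀ s, G'.wt a • p' a s + ∑ b ∈ nb G' a, p' b (s + c' a b)
      = G.wt a • p a s + ∑ b ∈ nb G a, p b (s + c a b) := by
    intro a ha s
    have hax : a ≠ x := fun e => f6 (e ▸ ha)
    have e : ∑ b ∈ nb G a, p' b (s + c' a b) = ∑ b ∈ nb G a, p b (s + c a b) := by
      refine Finset.sum_congr rfl fun b hb => ?_
      rw [hp b (nb_sub hb), hc a ha b (nb_sub hb)]
    by_cases hav : a = v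
    · subst hav
      rw [out_sum_v h, h.2.2.2.2, hpx, hv, e, show s + c' a x + c' x a = s by omega]
      simp only [f3, if_false, if_true, sub_smul, one_smul]
      abel
    · rw [out_nb_o h hav hax, h.2.2.2.2, e, hp a ha]
      simp only [hax, hav, if_false]
  have fl : ∑ a ∈ G'.verts, ∑ b ∈ nb G' a, c' a b * dt (p' a 0) (p' b (c' a b))
      = ∑ a ∈ G.verts, ∑ b ∈ nb G a, c a b * dt (p a 0) (p b (c a b)) := by
    rw [dsum_out h, hpx, hpx, hv, show c' v x + c' x v = 0 by omega, zero_add, dt_self, dt_self,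
      mul_zero, mul_zero, add_zero, add_zero]
    refine Finset.sum_congr rfl fun a ha => Finset.sum_congr rfl fun b hb => ?_
    rw [hp b (nb_sub hb), hc a ha b (nb_sub hb), hp a ha]
  constructor
  · intro H
    refine ⟨anti', sh', ?_, fl.trans H.fl⟩
    rw [h.2.2.1]
    intro a ha s
    rcases Finset.mem_insert.1 ha with rfl | ha
    · exact eqx s
    · rw [eqall a ha]; exact H.eq a ha s
  · intro H
    refine ⟨anti, sh, fun a ha s => ?_, fl.symm.trans H.fl⟩
    rw [← eqall a ha]
    exact H.eq a (by rw [h.2.2.1]; exact Finset.mem_insert_of_mem ha) s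

lemma QT_out {T : ℤ × ℤ →+ ℤ × ℤ}
    {G G' : WGraph} {v x : ℕ} (h : IsOuterBlowup G G' v x) : QT T G ↔ QT T G' := by
  have f6 := h.2.1
  have f3 : v ≠ x := fun e => f6 (e ▸ h.1)
  constructor
  · rintro ⟨c, p, H⟩
    refine ⟨fun a b => if a = x then 0 else if b = x then 0 else c a b,
      fun a => if a = x then p v else p a, ?_⟩
    refine (out_core h c _ p _ H.anti ?_ H.sh ?_ ?_ ?_ ?_).1 H
    · intro a b
      by_cases ha : a = x <;> by_cases hb : b = x
      · simp [ha, hb]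
      · simp [ha, hb]
      · simp [ha, hb]
      · simp [ha, hb]; exact H.anti a b
    · intro a s
      by_cases ha : a = x
      · simp only [ha, if_true]
        rw [H.sh]
      · simp only [ha, if_false]; exact H.sh a s
    · intro a ha
      have hax : a ≠ x := fun e => f6 (e ▸ ha)
      simp [hax]
    · intro a ha b hb
      have hax : a ≠ x := fun e => f6 (e ▸ ha)
      have hbx : b ≠ x := fun e => f6 (e ▸ hb)
      simp [hax, hbx]
    · intro s; simp
  · rintro ⟨c', p', H⟩
    refine ⟨c', p', (out_core h c' c' p' p' H.anti H.anti H.sh H.sh (fun _ _ => rfl)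
      (fun _ _ _ _ => rfl) ?_).2 H⟩
    intro s
    have := H.eq x (by rw [h.2.2.1]; exact Finset.mem_insert_self _ _) s
    rw [out_nb_x h, h.2.2.2.2] at this
    simp at this
    rw [neg_add_eq_zero] at this
    exact this

lemma QT_iso {T : ℤ × ℤ →+ ℤ × ℤ} {G G' : WGraph} (h : WIso G G') (hq : QT T G') : QT T G := by
  obtain ⟨f, hb, ha, hw⟩ := h
  obtain ⟨c, p, H⟩ := hq
  refine ⟨fun a b => c (f a) (f b), fun a => p (f a), fun a b => H.anti _ _, fun a s => H.sh _ _,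
    fun v hv s => ?_, ?_⟩
  · have := H.eq (f v) (hb.mapsTo hv) s
    rw [iso_nb hb ha hv, hw v hv] at this
    exact this
  · rw [← H.fl, iso_sum hb]
    exact Finset.sum_congr rfl fun v hv => by rw [iso_nb hb ha hv]

lemma QT_birEq {T : ℤ × ℤ →+ ℤ × ℤ} (hT : ∀ u v, dt (T u) (T v) = dt u v)
    {G G' : WGraph} (h : BirEq G G') : QT T G ↔ QT T G' := by
  refine inv_birEq ?_ (fun _ _ h => QT_iso h) h
  rintro G G' (⟨u, v, x, h⟩ | ⟨v, x, h⟩)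
  · exact QT_in hT h
  · exact QT_out h

end CycU
namespace CycU
open WGraph

structure Cyc (G : WGraph) (N : ℕ) (v : ℤ → ℕ) : Prop where
  big : 3 ≤ N
  per : ∀ i, v (i + N) = v i
  inj : ∀ i j, v i = v j → i % N = j % N
  mem : ∀ u, u ∈ G.verts ↔ ∃ i : ℤ, v i = u
  nbs : ∀ i, nb G (v i) = {v (i - 1), v (i + 1)}

lemma per_mul {X : Type*} {N : ℕ} {v : ℤ → X} (per : ∀ i, v (i + N) = v i) (i s : ℤ) :
    v (i + s * N) = v i := by
  induction s using Int.induction_on with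
  | zero => simp
  | succ m ih => rw [← ih, ← per (i + m * N)]; congr 1; ring
  | pred m ih => rw [← ih, ← per]; congr 1; ring

lemma per_mod {X : Type*} {N : ℕ} {v : ℤ → X} (per : ∀ i, v (i + N) = v i) (i : ℤ) :
    v (i % N) = v i := by
  have := per_mul per (i % N) (i / N)
  rw [← this]; congr 1
  have := Int.emod_add_ediv_mul i N
  omega

lemma Cyc.ne {G N v} (h : Cyc G N v) (i : ℤ) : v (i - 1) ≠ v (i + 1) := by
  intro e
  have e := h.inj _ _ e
  have := h.big
  have := Int.ModEq.dvd (show (i - 1) ≡ (i+1) [ZMOD N] from e)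
  have := Int.le_of_dvd (by norm_num) this
  omega

lemma Cyc.nbsum {G N v} (h : Cyc G N v) {M : Type*} [AddCommMonoid M] (F : ℕ → M) (i : ℤ) :
    ∑ u ∈ nb G (v i), F u = F (v (i - 1)) + F (v (i + 1)) := by
  rw [h.nbs, Finset.sum_pair (h.ne i)]

lemma Cyc.sum {G N v} (h : Cyc G N v) {M : Type*} [AddCommMonoid M] (F : ℕ → M) :
    ∑ u ∈ G.verts, F u = ∑ i ∈ Finset.range N, F (v i) := by
  have := h.big
  have e : G.verts = (Finset.range N).image (fun i : ℕ => v i) := by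
    ext u
    rw [h.mem]
    simp only [Finset.mem_image, Finset.mem_range]
    constructor
    · rintro ⟨i, rfl⟩
      have h1 := Int.emod_nonneg i (show (N : ℤ) ≠ 0 by omega)
      have h2 := Int.emod_lt_of_pos i (show (0 : ℤ) < N by omega)
      refine ⟨(i % N).toNat, by omega, ?_⟩
      rw [Int.toNat_of_nonneg h1, per_mod h.per]
    · rintro ⟨i, _, rfl⟩
      exact ⟨i, rfl⟩
  rw [e, Finset.sum_image]
  intro a ha b hb hab
  have := h.inj _ _ hab
  simp only [Finset.coe_range, Set.mem_Iio] at ha hb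
  rw [Int.emod_eq_of_lt (by omega) (by omega), Int.emod_eq_of_lt (by omega) (by omega)] at this
  exact_mod_cast this

lemma exCyc {G : WGraph} {l : List ℕ} (hG : G.IsCircular) (hl : G.CycList l) (hlen : 4 ≤ l.length) :
    ∃ v, Cyc G l.length v ∧ ∀ (j : ℕ) (h : j < l.length), v j = l[j] := by
  obtain ⟨nd, mem, ch, cl⟩ := hl
  have ed : ∀ (j : ℕ) (h : j < l.length),
      G.adj l[j] (l[(j + 1) % l.length]'(Nat.mod_lt _ (by omega))) = true := by
    intro j h
    by_cases h2 : j + 1 < l.length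
    · simp only [Nat.mod_eq_of_lt h2]
      exact List.isChain_iff_getElem.1 ch j h2
    · have : j + 1 = l.length := by omega
      simp only [this, Nat.mod_self]
      apply cl
      · rw [List.head?_eq_getElem?, List.getElem?_eq_getElem]
      · rw [List.getLast?_eq_getElem?, List.getElem?_eq_getElem]
        · simp [← this]
        · omega
  have hN : (l.length : ℤ) ≠ 0 := by omega
  have lt : ∀ i : ℤ, (i % l.length).toNat < l.length := by
    intro i
    have h2 := Int.emod_lt_of_pos i (show (0 : ℤ) < l.length by omega)
    omega
  set v : ℤ → ℕ := fun i => l[(i % l.length).toNat]'(lt i) with hv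
  have vn : ∀ i, v i ∈ G.verts := fun i => (mem _).1 (List.getElem_mem _)
  have adj1 : ∀ i, G.adj (v i) (v (i + 1)) = true := by
    intro i
    have := ed _ (lt i)
    convert this using 2
    simp only [hv]
    congr 1
    have h1 := Int.emod_nonneg i hN
    zify
    rw [Int.toNat_of_nonneg (Int.emod_nonneg _ hN), Int.toNat_of_nonneg h1, Int.emod_add_emod]
  have adj2 : ∀ i, G.adj (v i) (v (i - 1)) = true := by
    intro i
    apply G.symm
    have := adj1 (i - 1)
    rwa [sub_add_cancel] at this
  have inj : ∀ i j, v i = v j → i % l.length = j % l.length := by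
    intro i j e
    have := (nd.getElem_inj_iff).1 e
    have h1 := Int.emod_nonneg i hN
    have h2 := Int.emod_nonneg j hN
    omega
  have per : ∀ i, v (i + l.length) = v i := by
    intro i; simp only [hv, Int.add_emod_right]
  refine ⟨v, ⟨by omega, per, inj, ?_, ?_⟩, ?_⟩
  · intro u
    rw [← mem]
    constructor
    · intro hu
      obtain ⟨j, hj, rfl⟩ := List.getElem_of_mem hu
      refine ⟨j, ?_⟩
      simp only [hv, Int.emod_eq_of_lt (show (0 : ℤ) ≤ j by omega) (show (j : ℤ) < l.length by omega),
        Int.toNat_natCast]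
    · rintro ⟨i, rfl⟩; exact (mem _).2 (vn i)
  · intro i
    symm
    apply Finset.eq_of_subset_of_card_le
    · intro u hu
      simp only [Finset.mem_insert, Finset.mem_singleton] at hu
      rcases hu with rfl | rfl
      · exact mem_nb.2 (adj2 i)
      · exact mem_nb.2 (adj1 i)
    · have : (nb G (v i)).card = 2 := hG.2.2 _ (vn i)
      rw [this, Finset.card_pair]
      intro e
      have e := inj _ _ e
      have := Int.ModEq.dvd (show (i - 1) ≡ (i+1) [ZMOD l.length] from e)
      have := Int.le_of_dvd (by norm_num) this
      omega
  · intro j hj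
    simp only [hv, Int.emod_eq_of_lt (show (0 : ℤ) ≤ j by omega) (show (j : ℤ) < l.length by omega),
        Int.toNat_natCast]

lemma exCycW {G : WGraph} {l : List ℕ} (hG : G.IsCircular) (hl : G.CycList l) (hlen : 4 ≤ l.length)
    {k n : ℕ} {w : Fin n → ℤ} (hw : l.map G.wt = List.replicate (2 * k) 0 ++ List.ofFn w) :
    ∃ v, Cyc G (2 * k + n) v ∧ (∀ i : ℤ, 0 ≤ i → i < 2 * k → G.wt (v i) = 0) ∧
      ∀ r : Fin n, G.wt (v (2 * k + (r : ℕ))) = w r := by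
  have hN : l.length = 2 * k + n := by
    have := congrArg List.length hw
    simpa using this
  obtain ⟨v, h, e⟩ := exCyc hG hl hlen
  rw [hN] at h
  refine ⟨v, h, ?_, ?_⟩
  · intro i h1 h2
    lift i to ℕ using h1
    rw [e i (by omega), ← List.getElem_map (f := G.wt) (h := by simp; omega)]
    simp only [hw]
    rw [List.getElem_append_left (by simp; omega)]
    simp
  · intro r
    have := e (2 * k + r) (by omega)
    push_cast at this
    rw [this, ← List.getElem_map (f := G.wt) (h := by simp; omega)]
    simp only [hw]
    rw [List.getElem_append_right (by simp)]
    simp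

end CycU
namespace CycU
open WGraph

lemma Cyc.build {G N v} (h : Cyc G N v) : ∃ (P : ℤ → ℤ × ℤ) (T : ℤ × ℤ →+ ℤ × ℤ),
    Sq (fun i => - G.wt (v i)) P ∧ (∀ u v, dt (T u) (T v) = dt u v) ∧
    (∀ i, T (P i) = P (i + N)) ∧ QT T G := by
  have hN := h.big
  obtain ⟨P, P0, P1, hP⟩ := exR (fun i => - G.wt (v i)) (1, 0) (0, 1)
  have hd : ∀ i, dt (P i) (P (i + 1)) = 1 := by
    intro i; rw [constdet hP, P0, P1]; simp [dt]
  let T : ℤ × ℤ →+ ℤ × ℤ :=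
    { toFun := fun z => z.1 • P N + z.2 • P (N + 1)
      map_zero' := by simp
      map_add' := by intro a b; simp only [Prod.fst_add, Prod.snd_add, add_smul]; abel }
  have Tdef : ∀ z, T z = z.1 • P N + z.2 • P (N + 1) := fun z => rfl
  have hT : ∀ u v, dt (T u) (T v) = dt u v := by
    intro a b
    have := hd N
    rw [Tdef, Tdef]
    simp only [dt, Prod.fst_add, Prod.snd_add, Prod.smul_fst, Prod.smul_snd, smul_eq_mul] at this ⊢
    linear_combination (a.1 * b.2 - a.2 * b.1) * this
  have hTP : ∀ i, T (P i) = P (i + N) := by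
    intro i
    refine uniqR (A := fun i => - G.wt (v i)) (P := fun i => T (P i)) (R := fun i => P (i + N))
      ?_ ?_ ?_ ?_ i
    · intro i
      rw [← map_add, hP, map_zsmul]
    · intro i
      have := hP (i + N)
      simp only [h.per] at this ⊢
      rw [← this]; congr 2 <;> ring
    · simp [P0, Tdef]
    · simp [P1, Tdef, add_comm]
  have hTs : ∀ (j s : ℤ), P (j + (s + 1) * N) = T (P (j + s * N)) := by
    intro j s; rw [hTP]; congr 1; ring
  refine ⟨P, T, ⟨hP, hd⟩, hT, hTP, ?_⟩
  have hidx : ∀ u, ∃ j : ℤ, 0 ≤ j ∧ j < N ∧ (u ∈ G.verts → v j = u) := by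
    intro u
    by_cases hu : u ∈ G.verts
    · obtain ⟨i, rfl⟩ := (h.mem u).1 hu
      exact ⟨i % N, Int.emod_nonneg i (by omega), Int.emod_lt_of_pos i (by omega),
        fun _ => per_mod h.per i⟩
    · exact ⟨0, le_rfl, by omega, fun e => absurd e hu⟩
  choose idx i0 i1 i2 using hidx
  have vm : ∀ i, v i ∈ G.verts := fun i => (h.mem _).2 ⟨i, rfl⟩
  have iv : ∀ j : ℤ, 0 ≤ j → j < N → idx (v j) = j := by
    intro j h1 h2
    have := h.inj _ _ (i2 (v j) (vm j))
    rwa [Int.emod_eq_of_lt (i0 _) (i1 _), Int.emod_eq_of_lt h1 h2] at this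
  let c : ℕ → ℕ → ℤ := fun a b => if idx a - idx b = N - 1 then 1 else
    if idx b - idx a = N - 1 then -1 else 0
  have c1 : ∀ j : ℤ, 0 ≤ j → j < N → idx (v (j + 1)) + c (v j) (v (j + 1)) * N = j + 1 ∧
      c (v j) (v (j + 1)) = if j = N - 1 then 1 else 0 := by
    intro j h1 h2
    have e1 := iv j h1 h2
    by_cases hj : j = N - 1
    · have e2 : idx (v (j + 1)) = 0 := by
        rw [show v (j + 1) = v 0 by rw [← h.per 0]; congr 1; omega]
        exact iv 0 le_rfl (by omega)
      simp only [c, e1, e2]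
      split_ifs <;> omega
    · have e2 := iv (j + 1) (by omega) (by omega)
      simp only [c, e1, e2]
      split_ifs <;> omega
  have c2 : ∀ j : ℤ, 0 ≤ j → j < N → idx (v (j - 1)) + c (v j) (v (j - 1)) * N = j - 1 ∧
      c (v j) (v (j - 1)) = if j = 0 then -1 else 0 := by
    intro j h1 h2
    have e1 := iv j h1 h2
    by_cases hj : j = 0
    · have e2 : idx (v (j - 1)) = N - 1 := by
        rw [show v (j - 1) = v (N - 1) by rw [← h.per]; congr 1; omega]
        exact iv _ (by omega) (by omega)
      simp only [c, e1, e2]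
      split_ifs <;> omega
    · have e2 := iv (j - 1) (by omega) (by omega)
      simp only [c, e1, e2]
      split_ifs <;> omega
  refine ⟨c, fun u s => P (idx u + s * N), ?_, ?_, ?_, ?_⟩
  · intro a b
    simp only [c]
    split_ifs <;> omega
  · intro a s; exact hTs _ _
  · intro a ha s
    obtain ⟨j, rfl⟩ : ∃ j, j = idx a := ⟨_, rfl⟩
    have e := i2 a ha
    have b0 := i0 a
    have b1 := i1 a
    generalize idx a = j at e b0 b1
    subst e
    rw [h.nbsum]
    have q1 := (c1 j b0 b1).1
    have q2 := (c2 j b0 b1).1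
    rw [show idx (v (j - 1)) + (s + c (v j) (v (j - 1))) * N = j + s * N - 1 by linarith,
      show idx (v (j + 1)) + (s + c (v j) (v (j + 1))) * N = j + s * N + 1 by linarith, hP,
      per_mul h.per]
    simp
  · rw [h.sum]
    have : ∀ i ∈ Finset.range N, ∑ u ∈ nb G (v i), c (v i) u * dt (P (idx (v i) + 0 * N)) (P (idx u + c (v i) u * N)) = (if i = N - 1 then 1 else 0) + (if i = 0 then 1 else 0) := by
      intro i hi
      have hi := Finset.mem_range.1 hi
      obtain ⟨q1, q1'⟩ := c1 i (by omega) (by omega)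
      obtain ⟨q2, q2'⟩ := c2 i (by omega) (by omega)
      rw [h.nbsum, q1, q2, q1', q2', iv i (by omega) (by omega), zero_mul, add_zero, hd,
        dt_anti (P i) (P (i - 1))]
      have := hd (i - 1)
      rw [sub_add_cancel] at this
      rw [this]
      split_ifs <;> omega
    rw [Finset.sum_congr rfl this, Finset.sum_add_distrib]
    simp
    have : 0 < N := by omega
    simp [this]

lemma Cyc.extract {G N v} (h : Cyc G N v) {T : ℤ × ℤ →+ ℤ × ℤ}
    (hT : ∀ u v, dt (T u) (T v) = dt u v) (hq : QT T G) :
    ∃ P : ℤ → ℤ × ℤ, (∀ i, P (i - 1) + P (i + 1) = (- G.wt (v i)) • P i) ∧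
      (((∀ i, dt (P i) (P (i + 1)) = 1) ∧ ∀ i, T (P i) = P (i + N)) ∨
       ((∀ i, dt (P i) (P (i + 1)) = -1) ∧ ∀ i, T (P (i + N)) = P i)) := by
  obtain ⟨c, p, H⟩ := hq
  have vm : ∀ i, v i ∈ G.verts := fun i => (h.mem _).2 ⟨i, rfl⟩
  obtain ⟨C, -, hC⟩ := exZ (fun i => Equiv.addRight (c (v i) (v (i + 1)))) 0
  simp only [Equiv.coe_addRight] at hC
  have hC1 : ∀ i, c (v i) (v (i + 1)) = C (i + 1) - C i := by intro i; rw [hC]; ring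
  have hC2 : ∀ i, c (v i) (v (i - 1)) = C (i - 1) - C i := by
    intro i
    have := hC1 (i - 1)
    rw [sub_add_cancel] at this
    rw [H.anti, this]; ring
  let P : ℤ → ℤ × ℤ := fun i => p (v i) (C i)
  have hP : ∀ i, P (i - 1) + P (i + 1) = (- G.wt (v i)) • P i := by
    intro i
    have := H.eq (v i) (vm i) (C i)
    rw [h.nbsum, hC1, hC2, add_sub_cancel, add_sub_cancel] at this
    rw [neg_smul]
    exact (neg_eq_of_add_eq_zero_right this).symm
  have hm : ∀ i, C (i + N) = C i + (C N - C 0) := by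
    have step : ∀ i, C (i + 1 + N) - C (i + 1) = C (i + N) - C i := by
      intro i
      have e1 := hC1 i
      have e2 := hC1 (i + N)
      rw [show i + (N : ℤ) + 1 = i + 1 + N by ring, h.per, h.per] at e2
      omega
    intro i
    suffices C (i + N) - C i = C N - C 0 by omega
    induction i using Int.induction_on with
    | zero => simp
    | succ i ih => rw [step, ih]
    | pred i ih => rw [← ih, ← step, sub_add_cancel]
  have cd := constdet hP
  have fl := H.fl
  rw [h.sum] at fl
  have key : ∀ i ∈ Finset.range N, ∑ u ∈ nb G (v i), c (v i) u * dt (p (v i) 0) (p u (c (v i) u))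
      = dt (P 0) (P 1) * ((C ((i + 1 : ℕ)) - C (i : ℕ)) + (C (((i + 1 : ℕ) : ℤ) - 1) - C ((i : ℕ) - 1))) := by
    intro i _
    rw [h.nbsum, hC1, hC2]
    rw [← H.dtsh hT _ _ _ _ (C i), ← H.dtsh hT (v i) (v (i + 1)) _ _ (C i), zero_add, sub_add_cancel,
      sub_add_cancel]
    have e1 : dt (p (v i) (C i)) (p (v (i + 1)) (C (i + 1))) = dt (P 0) (P 1) := cd i
    have e2 : dt (p (v (i - 1)) (C (i - 1))) (p (v i) (C i)) = dt (P 0) (P 1) := by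
      have := cd (i - 1)
      rw [sub_add_cancel] at this
      exact this
    rw [e1, dt_anti, e2]
    push_cast
    rw [add_sub_cancel_right]
    ring
  rw [Finset.sum_congr rfl key, ← Finset.mul_sum, Finset.sum_add_distrib,
    Finset.sum_range_sub (fun i : ℕ => C i), Finset.sum_range_sub (fun i : ℕ => C ((i : ℤ) - 1))] at fl
  have e := hm (-1)
  rw [show (-1 : ℤ) + N = N - 1 by ring] at e
  simp only [Nat.cast_zero, zero_sub, e] at fl
  have fl2 : dt (P 0) (P 1) * (C N - C 0) = 1 := by linarith
  refine ⟨P, hP, ?_⟩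
  rcases Int.mul_eq_one_iff_eq_one_or_neg_one.1 fl2 with ⟨f1, f2⟩ | ⟨f1, f2⟩
  · left
    refine ⟨fun i => by rw [cd, f1], fun i => ?_⟩
    simp only [P]
    rw [h.per, hm, f2, H.sh]
  · right
    refine ⟨fun i => by rw [cd, f1], fun i => ?_⟩
    simp only [P]
    rw [h.per, hm, f2, ← H.sh]
    congr 1; ring

end CycU
namespace CycU
open WGraph

lemma Cyc.QF_eq {G N v} (h : Cyc G N v) (f : ℕ → ℝ) :
    QF G f = ∑ i ∈ Finset.range N,
      ((G.wt (v i) : ℝ) * f (v i) ^ 2 + 2 * f (v i) * f (v ((i + 1 : ℕ)))) := by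
  have t := Finset.sum_range_sub (fun i : ℕ => f (v i) * f (v ((i : ℤ) - 1))) N
  have t0 : v ((N : ℤ) - 1) = v (-1) := by rw [← h.per (-1), neg_add_eq_sub]
  have t1 : v (N : ℤ) = v 0 := by rw [← h.per 0, zero_add]
  simp only [Nat.cast_zero, zero_sub, t0, t1, sub_self] at t
  rw [QF, h.sum, h.sum, ← Finset.sum_add_distrib, ← sub_eq_zero, ← Finset.sum_sub_distrib, ← neg_eq_zero,
    ← t, ← Finset.sum_neg_distrib]
  refine Finset.sum_congr rfl fun i _ => ?_
  rw [h.nbsum]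
  push_cast
  rw [add_sub_cancel_right]
  ring

lemma sum_two (h : ℕ → ℝ) (k : ℕ) :
    ∑ i ∈ Finset.range (2 * k), h i = ∑ j ∈ Finset.range k, (h (2 * j) + h (2 * j + 1)) := by
  induction k with
  | zero => simp
  | succ k ih => rw [mul_add, Finset.sum_range_succ, Finset.sum_range_succ, ih, Finset.sum_range_succ]; ring

lemma QF_std {G k n v} (h : Cyc G (2 * k + n) v) (hz : ∀ i : ℤ, 0 ≤ i → i < 2 * k → G.wt (v i) = 0)
    (f : ℕ → ℝ) :
    QF G f = ∑ j ∈ Finset.range k, 2 * f (v (2 * j + 1 : ℕ)) * (f (v (2 * j : ℕ)) + f (v (2 * (j + 1) : ℕ)))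
      + ∑ j ∈ Finset.range n, ((G.wt (v (2 * k + j : ℕ)) : ℝ) * f (v (2 * k + j : ℕ)) ^ 2 +
        2 * f (v (2 * k + j : ℕ)) * f (v (2 * k + (j + 1) : ℕ))) := by
  rw [h.QF_eq, Finset.sum_range_add, sum_two]
  congr 1
  refine Finset.sum_congr rfl fun j hj => ?_
  have hj := Finset.mem_range.1 hj
  rw [hz (2 * j : ℕ) (by omega) (by push_cast; omega), hz (2 * j + 1 : ℕ) (by omega) (by push_cast; omega),
    show 2 * j + 1 + 1 = 2 * (j + 1) by ring]
  push_cast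
  ring

lemma PosDim_le {G k n v d} (h : Cyc G (2 * k + n) v)
    (hz : ∀ i : ℤ, 0 ≤ i → i < 2 * k → G.wt (v i) = 0)
    (hw : ∀ j : ℕ, j < n → G.wt (v (2 * k + j : ℕ)) ≤ -2) (hd : PosDim d G) : d ≤ k := by
  by_contra hk
  obtain ⟨φ, hφ⟩ := hd
  let L : (Fin d → ℝ) →ₗ[ℝ] (Fin k → ℝ) := LinearMap.pi fun j =>
    ((LinearMap.proj (v (2 * (j : ℕ) : ℕ)) : (ℕ → ℝ) →ₗ[ℝ] ℝ) +
      (LinearMap.proj (v (2 * ((j : ℕ) + 1) : ℕ)) : (ℕ → ℝ) →ₗ[ℝ] ℝ)) ∘ₗ φ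
  have hL := LinearMap.ker_ne_bot_of_finrank_lt (f := L) (by simp; omega)
  obtain ⟨a, ha, ha0⟩ := Submodule.exists_mem_ne_zero_of_ne_bot hL
  have pos := hφ a ha0
  have hc : ∀ j < k, φ a (v (2 * j : ℕ)) + φ a (v (2 * (j + 1) : ℕ)) = 0 := by
    intro j hj
    have := congrFun (LinearMap.mem_ker.1 ha) ⟨j, hj⟩
    simpa [L] using this
  rw [QF_std h hz] at pos
  generalize φ a = f at pos hc
  have sq : ∀ j ≤ k, f (v (2 * j : ℕ)) ^ 2 = f (v 0) ^ 2 := by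
    intro j hj
    induction j with
    | zero => simp
    | succ j ih =>
      have e := hc j (by omega)
      rw [← ih (by omega), eq_neg_of_add_eq_zero_right e]; ring
  have s1 : ∑ j ∈ Finset.range k, 2 * f (v (2 * j + 1 : ℕ)) * (f (v (2 * j : ℕ)) + f (v (2 * (j + 1) : ℕ))) = 0 := by
    refine Finset.sum_eq_zero fun j hj => ?_
    rw [hc j (Finset.mem_range.1 hj), mul_zero]
  have s2 : ∑ j ∈ Finset.range n, ((G.wt (v (2 * k + j : ℕ)) : ℝ) * f (v (2 * k + j : ℕ)) ^ 2 +
        2 * f (v (2 * k + j : ℕ)) * f (v (2 * k + (j + 1) : ℕ))) ≤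
      ∑ j ∈ Finset.range n, (f (v (2 * k + (j + 1) : ℕ)) ^ 2 - f (v (2 * k + j : ℕ)) ^ 2) := by
    refine Finset.sum_le_sum fun j hj => ?_
    have : (G.wt (v (2 * k + j : ℕ)) : ℝ) ≤ -2 := by exact_mod_cast hw j (Finset.mem_range.1 hj)
    nlinarith [sq_nonneg (f (v (2 * k + j : ℕ)) - f (v (2 * k + (j + 1) : ℕ))),
      sq_nonneg (f (v (2 * k + j : ℕ)))]
  rw [Finset.sum_range_sub (fun j : ℕ => f (v (2 * k + j : ℕ)) ^ 2)] at s2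
  have e : v (2 * k + n : ℕ) = v 0 := by rw [← h.per 0]; simp
  rw [e, add_zero, sq k le_rfl] at s2
  linarith

lemma PosDim_std {G k n v} (hn : 1 ≤ n) (h : Cyc G (2 * k + n) v)
    (hz : ∀ i : ℤ, 0 ≤ i → i < 2 * k → G.wt (v i) = 0) : PosDim k G := by
  have hidx : ∀ u, ∃ j : ℕ, ∀ i : ℕ, i < 2 * k + n → v i = u → j = i := by
    intro u
    by_cases hu : ∃ i : ℕ, i < 2 * k + n ∧ v i = u
    · obtain ⟨i, hi, rfl⟩ := hu
      refine ⟨i, fun j hj e => ?_⟩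
      have := h.inj _ _ e
      rw [Int.emod_eq_of_lt (by omega) (by omega), Int.emod_eq_of_lt (by omega) (by omega)] at this
      omega
    · exact ⟨0, fun i hi e => absurd ⟨i, hi, e⟩ hu⟩
  choose idx hidx using hidx
  let e : (Fin k → ℝ) → ℕ → ℝ := fun a j => if h : j < k then a ⟨j, h⟩ else 0
  have eadd : ∀ a b j, e (a + b) j = e a j + e b j := by
    intro a b j; simp only [e]; split_ifs <;> simp
  have esm : ∀ (r : ℝ) a j, e (r • a) j = r * e a j := by
    intro a b j; simp only [e]; split_ifs <;> simp
  let g : (Fin k → ℝ) → ℕ → ℝ := fun a i => if i % 2 = 0 then e a (i / 2) else e a (i / 2) + e a (i / 2 + 1)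
  let φ : (Fin k → ℝ) →ₗ[ℝ] (ℕ → ℝ) :=
    { toFun := fun a u => g a (idx u)
      map_add' := by
        intro a b; ext u; simp only [g, Pi.add_apply, eadd]; split_ifs <;> ring
      map_smul' := by
        intro a b; ext u; simp only [g, Pi.smul_apply, esm, smul_eq_mul, RingHom.id_apply]; split_ifs <;> ring }
  have hφ : ∀ a (i : ℕ), i < 2 * k + n → φ a (v i) = g a i := by
    intro a i hi
    show g a (idx (v i)) = _
    rw [hidx _ i hi rfl]
  refine ⟨φ, fun a ha => ?_⟩
  have ek : e a k = 0 := by simp [e]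
  have ek' : ∀ j, k ≤ j → e a j = 0 := by intro j hj; simp only [e]; rw [dif_neg]; omega
  have ge : ∀ j, g a (2 * j) = e a j := by intro j; simp [g]
  have go : ∀ j, g a (2 * j + 1) = e a j + e a (j + 1) := by
    intro j
    simp only [g]
    rw [if_neg (by omega), show (2 * j + 1) / 2 = j by omega]
  have gb : ∀ i, 2 * k ≤ i → g a i = 0 := by
    intro i hi; simp only [g]
    rw [ek' _ (by omega), ek' _ (by omega)]; simp
  have s2 : ∑ j ∈ Finset.range n, ((G.wt (v (2 * k + j : ℕ)) : ℝ) * φ a (v (2 * k + j : ℕ)) ^ 2 +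
        2 * φ a (v (2 * k + j : ℕ)) * φ a (v (2 * k + (j + 1) : ℕ))) = 0 := by
    refine Finset.sum_eq_zero fun j hj => ?_
    have hj := Finset.mem_range.1 hj
    rw [hφ a (2 * k + j) (by omega), gb _ (by omega)]; ring
  have s1 : ∑ j ∈ Finset.range k, 2 * φ a (v (2 * j + 1 : ℕ)) * (φ a (v (2 * j : ℕ)) + φ a (v (2 * (j + 1) : ℕ)))
      = ∑ j ∈ Finset.range k, 2 * (e a j + e a (j + 1)) ^ 2 := by
    refine Finset.sum_congr rfl fun j hj => ?_
    have hj := Finset.mem_range.1 hj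
    rw [hφ a (2 * j) (by omega), hφ a (2 * j + 1) (by omega), hφ a (2 * (j + 1)) (by omega), ge, ge, go]
    ring
  rw [QF_std h hz, s1, s2, add_zero]
  refine lt_of_le_of_ne (Finset.sum_nonneg fun j _ => by positivity) fun h0 => ha ?_
  have h0 := (Finset.sum_eq_zero_iff_of_nonneg (fun j _ => by positivity)).1 h0.symm
  have all : ∀ m ≤ k, e a (k - m) = 0 := by
    intro m hm
    induction m with
    | zero => exact ek
    | succ m ih =>
      have h1 := h0 (k - (m + 1)) (Finset.mem_range.2 (by omega))
      rw [show k - (m + 1) + 1 = k - m by omega, ih (by omega)] at h1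
      simpa using h1
  ext j
  have := all (k - j) (by omega)
  rw [show k - (k - (j : ℕ)) = j by omega] at this
  simpa [e] using this

lemma k_le {G G' k k' n n' v v'} (hn : 1 ≤ n) (h : Cyc G (2 * k + n) v) (h' : Cyc G' (2 * k' + n') v')
    (hz : ∀ i : ℤ, 0 ≤ i → i < 2 * k → G.wt (v i) = 0)
    (hz' : ∀ i : ℤ, 0 ≤ i → i < 2 * k' → G'.wt (v' i) = 0)
    (hw' : ∀ j : ℕ, j < n' → G'.wt (v' (2 * k' + j : ℕ)) ≤ -2) (hb : BirEq G G') : k ≤ k' :=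
  PosDim_le h' hz' hw' ((inv_birEq (R := PosDim k) (fun _ _ h => PosDim_step h k)
    (fun _ _ h => PosDim_iso h k) hb).1 (PosDim_std hn h hz))

/-- the periodic extension of a word -/
def wext {n : ℕ} (hn : 1 ≤ n) (w : Fin n → ℤ) (i : ℤ) : ℤ :=
  w ⟨(i % n).toNat, by
    have := Int.emod_lt_of_pos i (show (0 : ℤ) < n by omega)
    omega⟩

lemma wext_per {n : ℕ} (hn : 1 ≤ n) (w : Fin n → ℤ) (i : ℤ) : wext hn w (i + n) = wext hn w i := by
  simp [wext]

lemma wext_nat {n : ℕ} (hn : 1 ≤ n) (w : Fin n → ℤ) (r : Fin n) : wext hn w ((r : ℕ) : ℤ) = w r := by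
  simp only [wext]
  congr 1
  ext
  simp only
  rw [Int.emod_eq_of_lt (by omega) (by omega)]; simp

lemma wext_rot {n : ℕ} (hn : 1 ≤ n) (w w' : Fin n → ℤ) (s : ℤ)
    (h : ∀ j, wext hn w' j = wext hn w (j + s)) :
    ∃ r : ℕ, List.ofFn w' = (List.ofFn w).rotate r := by
  refine ⟨(s % n).toNat, ?_⟩
  apply List.ext_getElem
  · simp
  · intro i h1 h2
    rw [List.getElem_rotate]
    simp only [List.getElem_ofFn, List.length_ofFn]
    have h3 : i < n := by simpa using h1
    have := h i
    rw [wext_nat hn w' ⟨i, h3⟩] at this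
    rw [this]
    simp only [wext]
    congr 2
    have e0 := Int.emod_nonneg s (show (n : ℤ) ≠ 0 by omega)
    zify
    rw [Int.toNat_of_nonneg (Int.emod_nonneg _ (by omega)), Int.toNat_of_nonneg e0, Int.add_emod_emod]

end CycU
namespace CycU
open WGraph

theorem final
    (Γ Γ' : WGraph) (l l' : List ℕ) (k k' n n' : ℕ)
    (w : Fin n → ℤ) (w' : Fin n' → ℤ)
    (hn : 1 ≤ n) (hn' : 1 ≤ n')
    (hΓ : Γ.IsCircular) (hΓ' : Γ'.IsCircular)
    (hl : Γ.CycList l) (hl' : Γ'.CycList l')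
    (hlen : 4 ≤ l.length) (hlen' : 4 ≤ l'.length)
    (hwseq : l.map Γ.wt = List.replicate (2 * k) 0 ++ List.ofFn w)
    (hwseq' : l'.map Γ'.wt = List.replicate (2 * k') 0 ++ List.ofFn w')
    (hw : ∀ i, w i ≤ -2) (hw' : ∀ j, w' j ≤ -2)
    (h : BirEq Γ Γ') :
    k = k' ∧ n = n' ∧
      ∃ r : ℕ, List.ofFn w' = (List.ofFn w).rotate r ∨
        List.ofFn w' = ((List.ofFn w).rotate r).reverse := by
  obtain ⟨v, hv, hz, hr⟩ := exCycW hΓ hl hlen hwseq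
  obtain ⟨v', hv', hz', hr'⟩ := exCycW hΓ' hl' hlen' hwseq'
  have hkk : k = k' := by
    apply le_antisymm
    · refine k_le hn hv hv' hz hz' (fun j hj => ?_) h
      have := hr' ⟨j, hj⟩
      push_cast
      rw [this]; exact hw' _
    · refine k_le hn' hv' hv hz' hz (fun j hj => ?_) (Relation.EqvGen.symm _ _ h)
      have := hr ⟨j, hj⟩
      push_cast
      rw [this]; exact hw _
  subst hkk
  refine ⟨rfl, ?_⟩
  obtain ⟨P, T, hP, hT, hTP, hQ⟩ := hv.build
  have hQ' := (QT_birEq hT h).1 hQ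
  obtain ⟨P', hP', hcase⟩ := hv'.extract hT hQ'
  have hA : ∀ r : ℤ, 0 ≤ r → r < n → - Γ.wt (v (2 * k + r)) = - wext hn w r := by
    intro r h1 h2
    lift r to ℕ using h1
    have := hr ⟨r, by omega⟩
    simp only at this
    rw [this, ← wext_nat hn w]
  have hA' : ∀ r : ℤ, 0 ≤ r → r < n' → - Γ'.wt (v' (2 * k + r)) = - wext hn' w' r := by
    intro r h1 h2
    lift r to ℕ using h1
    have := hr' ⟨r, by omega⟩
    simp only at this
    rw [this, ← wext_nat hn' w']
  rcases hcase with ⟨hd, hTP'⟩ | ⟨hd, hTP'⟩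
  · obtain ⟨e, s, hs⟩ := words k n n' hn hn' (fun i => - Γ.wt (v i)) (fun i => - wext hn w i)
      (fun i => - Γ'.wt (v' i)) (fun i => - wext hn' w' i) P P' hP ⟨hP', hd⟩ T hT hTP hTP'
      (fun i h1 h2 => by simp [hz i h1 h2]) (fun i => by simp only [wext_per])
      (fun i h1 h2 => by simp [hz' i h1 h2]) (fun i => by simp only [wext_per])
      hA hA' (fun i => by simp only [wext]; have := hw ⟨(i % n).toNat, by have := Int.emod_lt_of_pos i (show (0 : ℤ) < n by omega); omega⟩; omega)
      (fun i => by simp only [wext]; have := hw' ⟨(i % n').toNat, by have := Int.emod_lt_of_pos i (show (0 : ℤ) < n' by omega); omega⟩; omega)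
    subst e
    refine ⟨rfl, ?_⟩
    obtain ⟨r, hr⟩ := wext_rot hn w w' s (fun j => by have := hs j; omega)
    exact ⟨r, Or.inl hr⟩
  · obtain ⟨e, s, hs⟩ := words k n n' hn hn' (fun i => - Γ.wt (v i)) (fun i => - wext hn w i)
      (fun i => - Γ'.wt (v' (2 * k - 1 - i))) (fun i => - wext hn' (fun j => w' j.rev) i) P
      (fun i => P' (2 * k - 1 - i)) hP
      ⟨fun i => by
        rw [← hP' (2 * k - 1 - i), add_comm]
        congr 2 <;> ring, fun i => by
        have := hd (2 * k - 1 - (i + 1))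
        rw [show 2 * (k : ℤ) - 1 - (i + 1) + 1 = 2 * k - 1 - i by ring] at this
        rw [dt_anti, this]; rfl⟩ T hT hTP
      (fun i => by
        rw [← hTP' (2 * k - 1 - (i + (2 * k + n' : ℕ))), sub_add_eq_sub_sub, sub_add_cancel])
      (fun i h1 h2 => by simp [hz i h1 h2]) (fun i => by simp only [wext_per])
      (fun i h1 h2 => by rw [hz' _ (by omega) (by omega)]; rfl)
      (fun i => by simp only [wext_per])
      hA (fun r h1 h2 => by
        lift r to ℕ using h1
        have h3 : r < n' := by omega
        have := hr' (Fin.rev ⟨r, h3⟩)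
        have e := wext_nat hn' (fun j => w' j.rev) ⟨r, h3⟩
        simp only at e
        rw [e, ← this, ← hv'.per (2 * k - 1 - (2 * k + r))]
        congr 3
        rw [Fin.val_rev]
        push_cast [Nat.cast_sub (show r + 1 ≤ n' by omega)]
        ring)
      (fun i => by simp only [wext]; have := hw ⟨(i % n).toNat, by have := Int.emod_lt_of_pos i (show (0 : ℤ) < n by omega); omega⟩; omega)
      (fun i => by simp only [wext]; have := hw' (Fin.rev ⟨(i % n').toNat, by have := Int.emod_lt_of_pos i (show (0 : ℤ) < n' by omega); omega⟩); omega)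
    subst e
    refine ⟨rfl, ?_⟩
    obtain ⟨r, hr⟩ := wext_rot hn w (fun j => w' j.rev) s (fun j => by have := hs j; omega)
    refine ⟨r, Or.inr ?_⟩
    rw [← hr]
    apply List.ext_getElem
    · simp
    · intro i h1 h2
      have h3 : i < n := by simpa using h1
      simp only [List.getElem_reverse, List.getElem_ofFn, List.length_ofFn]
      congr 1
      ext
      simp only [Fin.val_rev]
      omega

end CycU

open WGraph in
/-- Corollary 3.33, circular case: if two standard circular weighted
graphs — cycles of length at least `4` with weight sequences
`(0,…,0 (2k zeros), w₁,…,wₙ)` and `(0,…,0 (2k' zeros), w'₁,…,w'ₙ')`, where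
`n, n' ≥ 1` and all `wᵢ, w'ⱼ ≤ -2` — are birationally equivalent, then `k = k'`,
`n = n'`, and `(w'₁,…,w'ₙ)` is obtained from `(w₁,…,wₙ)` by a cyclic permutation,
possibly followed by reversal: a circular standard graph is unique in its birational
equivalence class up to a cyclic permutation of its nonzero weights and reversion. -/
theorem standard_circular_unique_up_to_cyclic_permutation_and_reversion
    (Γ Γ' : WGraph) (l l' : List ℕ) (k k' n n' : ℕ)
    (w : Fin n → ℤ) (w' : Fin n' → ℤ)
    (hn : 1 ≤ n) (hn' : 1 ≤ n')
    (hΓ : Γ.IsCircular) (hΓ' : Γ'.IsCircular)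
    (hl : Γ.CycList l) (hl' : Γ'.CycList l')
    (hlen : 4 ≤ l.length) (hlen' : 4 ≤ l'.length)
    (hwseq : l.map Γ.wt = List.replicate (2 * k) 0 ++ List.ofFn w)
    (hwseq' : l'.map Γ'.wt = List.replicate (2 * k') 0 ++ List.ofFn w')
    (hw : ∀ i, w i ≤ -2) (hw' : ∀ j, w' j ≤ -2)
    (h : BirEq Γ Γ') :
    k = k' ∧ n = n' ∧
      ∃ r : ℕ, List.ofFn w' = (List.ofFn w).rotate r ∨
        List.ofFn w' = ((List.ofFn w).rotate r).reverse := by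
  exact CycU.final Γ Γ' l l' k k' n n' w w' hn hn' hΓ hΓ' hl hl' hlen hlen' hwseq hwseq' hw hw' h
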